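/- Suppose the high temperature condition holds with parameters q ∈ [0,1) and K > 0. Let g₁,…,g_N be i.i.d. standard Gaussian random variables independent of the disorder (g_{ij})_{i<j}, and define the cavity field ℓ := (1/√N) Σ_{i=1}^N g_i σ_i, so that ⟨ℓ⟩ = (1/√N) Σ_{i=1}^N g_i ⟨σ_i⟩. Then there exists a constant C depending only on β, h, K such that for every N ≥ 2 for which the high temperature condition holds and every bounded measurable u : ℝ → ℝ, E( ⟨u(ℓ)⟩ - ∫_ℝ u(t) φ_{⟨ℓ⟩, 1-q}(t) dt )² ≤ C ‖u‖_∞² / √N. -/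

import Mathlib

open MeasureTheory ProbabilityTheory Real Finset

namespace SK

/-- Index set of pairs `i < j` in `Fin N`. -/
abbrev Pairs (N : ℕ) := {p : Fin N × Fin N // p.1 < p.2}

/-- The disorder: one real coordinate per pair. -/
abbrev Disorder (N : ℕ) := Pairs N → ℝ

/-- Law of the disorder: i.i.d. standard Gaussians. -/
noncomputable def μdis (N : ℕ) : Measure (Disorder N) :=
  Measure.pi fun _ => gaussianReal 0 1

/-- The symmetric extension `g_{ij}` of the disorder. -/
noncomputable def gval {N : ℕ} (G : Disorder N) (i j : Fin N) : ℝ :=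
  if hij : i < j then G ⟨(i, j), hij⟩ else if hji : j < i then G ⟨(j, i), hji⟩ else 0

abbrev Config (N : ℕ) := Fin N → Bool

/-- Spins `±1`. -/
def spin (b : Bool) : ℝ := if b then 1 else -1

/-- (Negative) Hamiltonian of the SK model. -/
noncomputable def ham {N : ℕ} (β h : ℝ) (G : Disorder N) (σ : Config N) : ℝ :=
  (β / Real.sqrt N) * ∑ p : Pairs N, G p * spin (σ p.1.1) * spin (σ p.1.2)
    + h * ∑ i, spin (σ i)

/-- Partition function. -/
noncomputable def Zpart {N : ℕ} (β h : ℝ) (G : Disorder N) : ℝ :=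
  ∑ σ : Config N, Real.exp (ham β h G σ)

/-- Gibbs measure. -/
noncomputable def gibbs {N : ℕ} (β h : ℝ) (G : Disorder N) (σ : Config N) : ℝ :=
  Real.exp (ham β h G σ) / Zpart β h G

/-- Quenched average of a function of one replica. -/
noncomputable def qavg {N : ℕ} (β h : ℝ) (G : Disorder N) (f : Config N → ℝ) : ℝ :=
  ∑ σ : Config N, f σ * gibbs β h G σ

/-- Quenched average of a function of two replicas. -/
noncomputable def qavg2 {N : ℕ} (β h : ℝ) (G : Disorder N)
    (f : Config N → Config N → ℝ) : ℝ :=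
  ∑ σ1 : Config N, ∑ σ2 : Config N, f σ1 σ2 * gibbs β h G σ1 * gibbs β h G σ2

/-- Overlap of two configurations. -/
noncomputable def overlap {N : ℕ} (σ1 σ2 : Config N) : ℝ :=
  (1 / (N : ℝ)) * ∑ i, spin (σ1 i) * spin (σ2 i)

/-- The high temperature condition `E⟨(R₁₂ - q)⁴⟩ ≤ K/N²`. -/
def highTemp (N : ℕ) (β h q K : ℝ) : Prop :=
  ∫ G, qavg2 β h G (fun σ1 σ2 => (overlap σ1 σ2 - q) ^ 4) ∂(μdis N) ≤ K / (N : ℝ) ^ 2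

/-- Magnetization `⟨σ_i⟩`. -/
noncomputable def mavg {N : ℕ} (β h : ℝ) (G : Disorder N) (i : Fin N) : ℝ :=
  qavg β h G fun σ => spin (σ i)

/-- Local field `ℓ_i`. -/
noncomputable def locField {N : ℕ} (G : Disorder N) (i : Fin N) (σ : Config N) : ℝ :=
  (1 / Real.sqrt N) * ∑ j ∈ Finset.univ.erase i, gval G i j * spin (σ j)

/-- The field `r_i`. -/
noncomputable def rfield {N : ℕ} (β h q : ℝ) (G : Disorder N) (i : Fin N) : ℝ :=
  (1 / Real.sqrt N) * ∑ j ∈ Finset.univ.erase i, gval G i j * mavg β h G j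
    - β * (1 - q) * mavg β h G i

/-- Gaussian density `φ_{μ,v}` with mean `μ` and variance `v`. -/
noncomputable def gaussDens (μ v x : ℝ) : ℝ :=
  (1 / (Real.sqrt (2 * π) * Real.sqrt v)) * Real.exp (-(x - μ) ^ 2 / (2 * v))

/-- Mixture-Gaussian density `ψ_{a,b,μ,v}`. -/
noncomputable def mixDens (a b μ v x : ℝ) : ℝ :=
  Real.cosh (a * x + b) * Real.exp (-(x - μ) ^ 2 / (2 * v)) /
    (Real.sqrt (2 * π) * Real.sqrt v * Real.cosh (a * μ + b) * Real.exp (a ^ 2 * v / 2))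

/-- The standard Gaussian measure on `J → ℝ`. -/
noncomputable abbrev stdGauss (J : Type*) [Fintype J] : Measure (J → ℝ) :=
  Measure.pi fun _ => gaussianReal 0 1

section LinearForms

variable {J : Type*} [Fintype J]

lemma hasGaussianLaw_stdGauss :
    HasGaussianLaw (fun g : J → ℝ => fun i => g i) (stdGauss J) := by
  refine iIndepFun.hasGaussianLaw (X := fun i (g : J → ℝ) => g i) (fun i => ?_)
    (iIndepFun_pi (X := fun _ x => x) fun i => aemeasurable_id)
  have : HasLaw (fun g : J → ℝ => g i) (gaussianReal 0 1) (stdGauss J) :=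
    (measurePreserving_eval (fun _ : J => gaussianReal 0 1) i).hasLaw
  exact this.hasGaussianLaw

lemma hasGaussianLaw_dotProduct_prodMk (a b : J → ℝ) :
    HasGaussianLaw (fun g : J → ℝ => (a ⬝ᵥ g, b ⬝ᵥ g)) (stdGauss J) :=
  (hasGaussianLaw_stdGauss (J := J)).map_fun
    (LinearMap.toContinuousLinearMap
      ((LinearMap.prod (dotProductBilin ℝ ℝ a) (dotProductBilin ℝ ℝ b) :
        (J → ℝ) →ₗ[ℝ] ℝ × ℝ)))

lemma covariance_dotProduct (a b : J → ℝ) :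
    cov[fun g : J → ℝ => a ⬝ᵥ g, fun g => b ⬝ᵥ g; stdGauss J] = a ⬝ᵥ b := by
  classical
  have hm : ∀ i, MemLp (fun g : J → ℝ => g i) 2 (stdGauss J) := fun i =>
    (hasGaussianLaw_stdGauss.eval i).memLp_two
  have hc : ∀ i j, cov[fun g : J → ℝ => g i, fun g => g j; stdGauss J]
      = if i = j then 1 else 0 := by
    intro i j
    split_ifs with hij
    · subst hij
      rw [covariance_self (measurable_pi_apply i).aemeasurable]
      have := (measurePreserving_eval (fun _ : J => gaussianReal 0 1) i).variance_fun_comp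
        (f := id) aemeasurable_id
      simpa using this
    · have := (iIndepFun_pi (μ := fun _ : J => gaussianReal 0 1) (X := fun _ x => x)
        fun i => aemeasurable_id).indepFun hij
      exact this.covariance_eq_zero (hm i) (hm j)
  simp only [dotProduct]
  rw [covariance_fun_sum_fun_sum (fun i => (hm i).const_mul _) (fun i => (hm i).const_mul _)]
  simp [covariance_const_mul_left, covariance_const_mul_right, hc, mul_comm]

lemma integral_dotProduct (a : J → ℝ) : ∫ g, a ⬝ᵥ g ∂stdGauss J = 0 := by
  simp only [dotProduct]
  rw [integral_finsetSum _ fun i _ =>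
    ((hasGaussianLaw_stdGauss.eval i).integrable).const_mul _]
  refine Finset.sum_eq_zero fun i _ => ?_
  rw [integral_const_mul]
  have := integral_comp_eval (μ := fun _ : J => gaussianReal 0 1) (i := i) (f := id)
    aestronglyMeasurable_id
  simp at this
  simp [this]

lemma map_dotProduct (a : J → ℝ) :
    (stdGauss J).map (fun g => a ⬝ᵥ g) = gaussianReal 0 (a ⬝ᵥ a).toNNReal := by
  rw [(hasGaussianLaw_dotProduct_prodMk a a).fst.map_eq_gaussianReal, integral_dotProduct,
    ← covariance_self (by fun_prop), covariance_dotProduct]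

lemma indepFun_dotProduct {a b : J → ℝ} (h : a ⬝ᵥ b = 0) :
    IndepFun (fun g : J → ℝ => a ⬝ᵥ g) (fun g => b ⬝ᵥ g) (stdGauss J) :=
  (hasGaussianLaw_dotProduct_prodMk a b).indepFun_of_covariance_eq_zero
    (by rw [covariance_dotProduct, h])

/-- Regression of one Gaussian linear form on another. -/
lemma integral_dotProduct_pair {a b : J → ℝ} (ha : 0 < a ⬝ᵥ a) {u w : ℝ → ℝ} {M : ℝ}
    (hu : Measurable u) (hw : Measurable w) (huM : ∀ x, |u x| ≤ M) (hwM : ∀ x, |w x| ≤ M) :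
    ∫ g, w (a ⬝ᵥ g) * u (b ⬝ᵥ g) ∂stdGauss J =
      ∫ x, w x * ∫ y, u y ∂gaussianReal (a ⬝ᵥ b / a ⬝ᵥ a * x)
        (b ⬝ᵥ b - (a ⬝ᵥ b) ^ 2 / a ⬝ᵥ a).toNNReal
      ∂gaussianReal 0 (a ⬝ᵥ a).toNNReal := by
  set t := a ⬝ᵥ b / a ⬝ᵥ a with ht
  set d : J → ℝ := b - t • a with hd
  have had : a ⬝ᵥ d = 0 := by
    simp only [hd, dotProduct_sub, dotProduct_smul, smul_eq_mul, ht]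
    field_simp; ring
  have hdd : d ⬝ᵥ d = b ⬝ᵥ b - (a ⬝ᵥ b) ^ 2 / a ⬝ᵥ a := by
    simp only [hd, dotProduct_sub, sub_dotProduct, dotProduct_smul, smul_dotProduct, smul_eq_mul,
      dotProduct_comm b a, ht]
    field_simp; ring
  have hb : ∀ g : J → ℝ, b ⬝ᵥ g = t * (a ⬝ᵥ g) + d ⬝ᵥ g := by
    intro g
    simp [hd, sub_dotProduct, smul_dotProduct]
  have hma : Measurable fun g : J → ℝ => a ⬝ᵥ g := by
    simp only [dotProduct]; fun_prop
  have hmd : Measurable fun g : J → ℝ => d ⬝ᵥ g := by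
    simp only [dotProduct]; fun_prop
  have hmap : (stdGauss J).map (fun g => (a ⬝ᵥ g, d ⬝ᵥ g)) =
      (gaussianReal 0 (a ⬝ᵥ a).toNNReal).prod (gaussianReal 0 (d ⬝ᵥ d).toNNReal) := by
    rw [(indepFun_iff_map_prod_eq_prod_map_map hma.aemeasurable hmd.aemeasurable).1
      (indepFun_dotProduct had), map_dotProduct, map_dotProduct]
  have hF : Measurable fun p : ℝ × ℝ => w p.1 * u (t * p.1 + p.2) := by fun_prop
  have hM : 0 ≤ M := (abs_nonneg _).trans (huM 0)
  rw [← hdd]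
  calc ∫ g, w (a ⬝ᵥ g) * u (b ⬝ᵥ g) ∂stdGauss J
      = ∫ p, w p.1 * u (t * p.1 + p.2) ∂((stdGauss J).map (fun g => (a ⬝ᵥ g, d ⬝ᵥ g))) := by
        rw [integral_map (hma.prodMk hmd).aemeasurable hF.aestronglyMeasurable]
        simp only [hb]
    _ = _ := by
        rw [hmap, integral_prod]
        · refine integral_congr_ae (ae_of_all _ fun x => ?_)
          simp only
          rw [integral_const_mul]
          congr 1
          have := gaussianReal_map_const_add (μ := 0) (v := (d ⬝ᵥ d).toNNReal) (t * x)
          rw [zero_add] at this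
          rw [← this, integral_map (by fun_prop) hu.aestronglyMeasurable]
        · refine Integrable.of_bound hF.aestronglyMeasurable (M * M) (ae_of_all _ fun p => ?_)
          rw [norm_mul]
          exact mul_le_mul (hwM _) (huM _) (norm_nonneg _) hM

end LinearForms

section TotalVariation

open scoped NNReal

/-- The Bhattacharyya coefficient of two Gaussian laws. -/
noncomputable def bhatt (m₁ m₂ v₁ v₂ : ℝ) : ℝ :=
  √(2 * (√v₁ * √v₂) / (v₁ + v₂)) * exp (-(m₁ - m₂) ^ 2 / (4 * (v₁ + v₂)))

lemma one_sub_bhatt_le (m₁ m₂ : ℝ) {v₁ v₂ : ℝ} (h₁ : 0 < v₁) (h₂ : 0 < v₂) :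
    1 - bhatt m₁ m₂ v₁ v₂ ≤ (|v₁ - v₂| / v₂) ^ 2 + (|m₁ - m₂| / √v₂) ^ 2 / 4 := by
  obtain ⟨r₁, hr₁, rfl⟩ : ∃ r, 0 < r ∧ v₁ = r ^ 2 := ⟨√v₁, sqrt_pos.2 h₁, (sq_sqrt h₁.le).symm⟩
  obtain ⟨r₂, hr₂, rfl⟩ : ∃ r, 0 < r ∧ v₂ = r ^ 2 := ⟨√v₂, sqrt_pos.2 h₂, (sq_sqrt h₂.le).symm⟩
  have hS : 0 < r₁ ^ 2 + r₂ ^ 2 := by positivity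
  set s := 2 * (r₁ * r₂) / (r₁ ^ 2 + r₂ ^ 2) with hs
  set y := (m₁ - m₂) ^ 2 / (4 * (r₁ ^ 2 + r₂ ^ 2)) with hy
  have hs0 : 0 ≤ s := by positivity
  have hy0 : 0 ≤ y := by positivity
  have hs1 : s ≤ 1 := by
    rw [hs, div_le_one hS]; nlinarith [sq_nonneg (r₁ - r₂)]
  have hB : bhatt m₁ m₂ (r₁ ^ 2) (r₂ ^ 2) = √s * exp (-y) := by
    rw [bhatt, sqrt_sq hr₁.le, sqrt_sq hr₂.le, hs, hy, neg_div]
  have hss : s ≤ √s := by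
    exact Real.le_sqrt_of_sq_le (by nlinarith)
  have hexp : 1 - y ≤ exp (-y) := by linarith [add_one_le_exp (-y)]
  have hBle : s - y ≤ √s * exp (-y) := by
    calc s - y ≤ s * (1 - y) := by nlinarith
      _ ≤ s * exp (-y) := mul_le_mul_of_nonneg_left hexp hs0
      _ ≤ √s * exp (-y) := mul_le_mul_of_nonneg_right hss (exp_pos _).le
  have h1s : 1 - s ≤ (|r₁ ^ 2 - r₂ ^ 2| / r₂ ^ 2) ^ 2 := by
    rw [div_pow, sq_abs]
    have : 1 - s = (r₁ - r₂) ^ 2 / (r₁ ^ 2 + r₂ ^ 2) := by rw [hs]; field_simp; ring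
    rw [this, div_le_div_iff₀ hS (by positivity)]
    have e : (r₁ ^ 2 - r₂ ^ 2) ^ 2 * (r₁ ^ 2 + r₂ ^ 2) =
      (r₁ - r₂) ^ 2 * ((r₁ + r₂) ^ 2 * (r₁ ^ 2 + r₂ ^ 2)) := by ring
    rw [e]
    refine mul_le_mul_of_nonneg_left ?_ (sq_nonneg _)
    calc (r₂ ^ 2) ^ 2 = r₂ ^ 2 * r₂ ^ 2 := by ring
      _ ≤ (r₁ + r₂) ^ 2 * (r₁ ^ 2 + r₂ ^ 2) := by
        gcongr <;> nlinarith [mul_pos hr₁ hr₂]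
  have hyle : y ≤ (|m₁ - m₂| / √(r₂ ^ 2)) ^ 2 / 4 := by
    rw [sqrt_sq hr₂.le, div_pow, sq_abs, hy, div_div, mul_comm _ (4 : ℝ)]
    gcongr
    nlinarith
  rw [hB]; linarith

lemma bhatt_le_one (m₁ m₂ : ℝ) {v₁ v₂ : ℝ} (h₁ : 0 < v₁) (h₂ : 0 < v₂) :
    bhatt m₁ m₂ v₁ v₂ ≤ 1 := by
  refine mul_le_one₀ (Real.sqrt_le_one.2 ?_) (exp_pos _).le (exp_le_one_iff.2 ?_)
  · rw [div_le_one (by positivity)]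
    nlinarith [sq_sqrt h₁.le, sq_sqrt h₂.le, sq_nonneg (√v₁ - √v₂)]
  · rw [neg_div]
    exact neg_nonpos.2 (by positivity)

lemma gaussianPDFReal_mul_gaussianPDFReal (m₁ m₂ x : ℝ) {v₁ v₂ : ℝ≥0} (h₁ : v₁ ≠ 0)
    (h₂ : v₂ ≠ 0) :
    √(gaussianPDFReal m₁ v₁ x) * √(gaussianPDFReal m₂ v₂ x) = bhatt m₁ m₂ v₁ v₂ *
      gaussianPDFReal ((v₂ * m₁ + v₁ * m₂) / (v₁ + v₂)) (2 * v₁ * v₂ / (v₁ + v₂)) x := by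
  have hv₁ : (0 : ℝ) < v₁ := NNReal.coe_pos.2 (pos_iff_ne_zero.2 h₁)
  have hv₂ : (0 : ℝ) < v₂ := NNReal.coe_pos.2 (pos_iff_ne_zero.2 h₂)
  rw [← sqrt_mul (gaussianPDFReal_nonneg _ _ _)]
  refine (sqrt_eq_iff_mul_self_eq
    (mul_nonneg (gaussianPDFReal_nonneg _ _ _) (gaussianPDFReal_nonneg _ _ _))
    (mul_nonneg (by unfold bhatt; positivity) (gaussianPDFReal_nonneg _ _ _))).2 ?_
  simp only [gaussianPDFReal, bhatt, NNReal.coe_div, NNReal.coe_mul, NNReal.coe_add,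
    NNReal.coe_ofNat]
  generalize (v₁ : ℝ) = a at *
  generalize (v₂ : ℝ) = b at *
  have hS : 0 < a + b := by positivity
  have e1 : √(2 * (√a * √b) / (a + b)) ^ 2 = 2 * (√a * √b) / (a + b) :=
    sq_sqrt (by positivity)
  have e2 : √(2 * π * (2 * a * b / (a + b))) ^ 2 = 2 * π * (2 * a * b / (a + b)) :=
    sq_sqrt (by positivity)
  have e3 : √(2 * π * a) * √(2 * π * b) = 2 * π * (√a * √b) := by
    rw [sqrt_mul (by positivity), sqrt_mul (by positivity) b]
    have := mul_self_sqrt (show (0 : ℝ) ≤ 2 * π by positivity)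
    linear_combination (√a * √b) * this
  have e4 : (√a * √b) ^ 2 = a * b := by rw [mul_pow, sq_sqrt hv₁.le, sq_sqrt hv₂.le]
  have hab : 0 < √a * √b := by positivity
  have e5 : exp (-(m₁ - m₂) ^ 2 / (4 * (a + b))) ^ 2 *
      exp (-(x - (b * m₁ + a * m₂) / (a + b)) ^ 2 / (2 * (2 * a * b / (a + b)))) ^ 2 =
      exp (-(x - m₁) ^ 2 / (2 * a)) * exp (-(x - m₂) ^ 2 / (2 * b)) := by
    rw [← exp_nat_mul, ← exp_nat_mul, ← exp_add, ← exp_add]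
    congr 1
    push_cast
    field_simp
    ring
  have e6 : √(2 * (√a * √b) / (a + b)) ^ 2 * (√(2 * π * (2 * a * b / (a + b))) ^ 2)⁻¹ =
      (√(2 * π * a) * √(2 * π * b))⁻¹ := by
    rw [e1, e2, e3]
    have : 2 * a * b = 2 * (√a * √b) ^ 2 := by rw [e4]; ring
    rw [this]
    field_simp
  symm
  calc _ = (√(2 * (√a * √b) / (a + b)) ^ 2 * (√(2 * π * (2 * a * b / (a + b))) ^ 2)⁻¹) *
        (exp (-(m₁ - m₂) ^ 2 / (4 * (a + b))) ^ 2 *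
      exp (-(x - (b * m₁ + a * m₂) / (a + b)) ^ 2 / (2 * (2 * a * b / (a + b)))) ^ 2) := by
        ring
    _ = _ := by
      rw [e5, e6, mul_inv]; ring

/-- Total variation comparison of two Gaussian laws on `ℝ`. -/
lemma abs_integral_gaussianReal_sub_le {u : ℝ → ℝ} {M : ℝ} (hu : Measurable u)
    (huM : ∀ x, |u x| ≤ M) (m₁ m₂ : ℝ) (v₁ : ℝ≥0) {v₂ : ℝ≥0} (h₂ : v₂ ≠ 0) :
    |∫ x, u x ∂gaussianReal m₁ v₁ - ∫ x, u x ∂gaussianReal m₂ v₂| ≤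
      M * (4 * (|(v₁ : ℝ) - v₂| / v₂) + 2 * (|m₁ - m₂| / √v₂)) := by
  have hM : 0 ≤ M := (abs_nonneg _).trans (huM 0)
  have hv₂ : (0 : ℝ) < v₂ := NNReal.coe_pos.2 (pos_iff_ne_zero.2 h₂)
  have hbd : ∀ m v, |∫ x, u x ∂gaussianReal m v| ≤ M := fun m v => by
    simpa using norm_integral_le_of_norm_le_const (μ := gaussianReal m v) (f := u) (C := M)
      (ae_of_all _ huM)
  rcases eq_or_ne v₁ 0 with rfl | h₁
  · have : |((0 : ℝ≥0) : ℝ) - v₂| / v₂ = 1 := by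
      rw [NNReal.coe_zero, zero_sub, abs_neg, abs_of_pos hv₂, div_self hv₂.ne']
    rw [this]
    have h3 : 0 ≤ |m₁ - m₂| / √(v₂ : ℝ) := by positivity
    calc _ ≤ M + M := (abs_sub _ _).trans (add_le_add (hbd _ _) (hbd _ _))
      _ ≤ _ := by nlinarith
  have hv₁ : (0 : ℝ) < v₁ := NNReal.coe_pos.2 (pos_iff_ne_zero.2 h₁)
  set δ := 2 * (|(v₁ : ℝ) - v₂| / v₂) + |m₁ - m₂| / √(v₂ : ℝ) with hδ
  have hA : 0 ≤ |(v₁ : ℝ) - v₂| / v₂ := by positivity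
  have hA' : 0 ≤ |m₁ - m₂| / √(v₂ : ℝ) := by positivity
  have hδ0 : 0 ≤ δ := by positivity
  suffices H : |∫ x, u x ∂gaussianReal m₁ v₁ - ∫ x, u x ∂gaussianReal m₂ v₂| ≤ M * (2 * δ) by
    refine H.trans_eq ?_
    rw [hδ]; ring
  rcases hδ0.eq_or_lt with h0 | hδpos
  · have hv : |(v₁ : ℝ) - v₂| / v₂ = 0 := by linarith
    have hm : |m₁ - m₂| / √(v₂ : ℝ) = 0 := by linarith
    rw [div_eq_zero_iff, abs_eq_zero, sub_eq_zero] at hv hm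
    have e1 : v₁ = v₂ := by
      rcases hv with hv | hv
      · exact_mod_cast hv
      · exact absurd hv hv₂.ne'
    have e2 : m₁ = m₂ := by
      rcases hm with hm | hm
      · exact hm
      · exact absurd hm (sqrt_pos.2 hv₂).ne'
    rw [e1, e2, sub_self, abs_zero]
    positivity
  set p₁ := gaussianPDFReal m₁ v₁
  set p₂ := gaussianPDFReal m₂ v₂
  set B := bhatt m₁ m₂ v₁ v₂ with hBdef
  have hw : 2 * v₁ * v₂ / (v₁ + v₂) ≠ 0 := by positivity
  have hp₁ : Integrable p₁ := integrable_gaussianPDFReal _ _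
  have hp₂ : Integrable p₂ := integrable_gaussianPDFReal _ _
  have hp₁0 : ∀ x, 0 ≤ p₁ x := gaussianPDFReal_nonneg _ _
  have hp₂0 : ∀ x, 0 ≤ p₂ x := gaussianPDFReal_nonneg _ _
  have hprod : ∀ x, √(p₁ x) * √(p₂ x) = B *
      gaussianPDFReal ((v₂ * m₁ + v₁ * m₂) / (v₁ + v₂)) (2 * v₁ * v₂ / (v₁ + v₂)) x := fun x =>
    gaussianPDFReal_mul_gaussianPDFReal m₁ m₂ x h₁ h₂
  set r := gaussianPDFReal ((v₂ * m₁ + v₁ * m₂) / (v₁ + v₂)) (2 * v₁ * v₂ / (v₁ + v₂))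
  have hr : Integrable r := integrable_gaussianPDFReal _ _
  have ip₁ : ∫ x, p₁ x = 1 := integral_gaussianPDFReal_eq_one _ h₁
  have ip₂ : ∫ x, p₂ x = 1 := integral_gaussianPDFReal_eq_one _ h₂
  have ir : ∫ x, r x = 1 := integral_gaussianPDFReal_eq_one _ hw
  set t := 2 / δ with ht
  have htpos : 0 < t := by positivity
  have hpt : ∀ x, |p₁ x - p₂ x| ≤
      (t + t⁻¹) / 2 * p₁ x + (t + t⁻¹) / 2 * p₂ x - (t - t⁻¹) * B * r x := by
    intro x
    have a1 := sq_sqrt (hp₁0 x)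
    have a2 := sq_sqrt (hp₂0 x)
    have a3 := hprod x
    set f₁ := √(p₁ x)
    set f₂ := √(p₂ x)
    have hf₁ : 0 ≤ f₁ := sqrt_nonneg _
    have hf₂ : 0 ≤ f₂ := sqrt_nonneg _
    have e : (t + t⁻¹) / 2 * p₁ x + (t + t⁻¹) / 2 * p₂ x - (t - t⁻¹) * B * r x =
        (t * (f₁ - f₂) ^ 2 + t⁻¹ * (f₁ + f₂) ^ 2) / 2 := by
      rw [mul_assoc, ← a3, ← a1, ← a2]; ring
    have e' : |p₁ x - p₂ x| = |f₁ - f₂| * (f₁ + f₂) := by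
      rw [← abs_of_nonneg (add_nonneg hf₁ hf₂), ← abs_mul, ← a1, ← a2]
      congr 1
      ring
    rw [e, e', ← sq_abs (f₁ - f₂)]
    have hk : t * t⁻¹ = 1 := mul_inv_cancel₀ htpos.ne'
    have := mul_nonneg htpos.le (sq_nonneg (|f₁ - f₂| - t⁻¹ * (f₁ + f₂)))
    have e3 : t * (|f₁ - f₂| - t⁻¹ * (f₁ + f₂)) ^ 2 = t * |f₁ - f₂| ^ 2
        + t⁻¹ * (f₁ + f₂) ^ 2 - 2 * (|f₁ - f₂| * (f₁ + f₂)) := by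
      linear_combination (-2 * |f₁ - f₂| * (f₁ + f₂) + t⁻¹ * (f₁ + f₂) ^ 2) * hk
    linarith
  have hint : Integrable fun x => (t + t⁻¹) / 2 * p₁ x + (t + t⁻¹) / 2 * p₂ x -
      (t - t⁻¹) * B * r x :=
    ((hp₁.const_mul _).add (hp₂.const_mul _)).sub (hr.const_mul _)
  have hL1 : ∫ x, |p₁ x - p₂ x| ≤ 2 * δ := by
    calc ∫ x, |p₁ x - p₂ x| ≤ ∫ x, ((t + t⁻¹) / 2 * p₁ x + (t + t⁻¹) / 2 * p₂ x -
        (t - t⁻¹) * B * r x) := integral_mono (hp₁.sub hp₂).abs hint hpt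
      _ = t * (1 - B) + t⁻¹ * (1 + B) := by
        rw [integral_sub (f := fun x => (t + t⁻¹) / 2 * p₁ x + (t + t⁻¹) / 2 * p₂ x)
          ((hp₁.const_mul _).add (hp₂.const_mul _)) (hr.const_mul _),
          integral_add (hp₁.const_mul _) (hp₂.const_mul _), integral_const_mul,
          integral_const_mul, integral_const_mul, ip₁, ip₂, ir]
        ring
      _ ≤ 2 * δ := by
        have hB := one_sub_bhatt_le m₁ m₂ hv₁ hv₂
        rw [← hBdef] at hB
        have hB1 : 1 - B ≤ δ ^ 2 / 2 := by
          rw [hδ]; nlinarith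
        have hB2 : B ≤ 1 := bhatt_le_one m₁ m₂ hv₁ hv₂
        have e1 : t * (1 - B) ≤ δ := by
          rw [ht, div_mul_eq_mul_div, div_le_iff₀ hδpos]; nlinarith
        have e2 : t⁻¹ * (1 + B) ≤ δ := by
          rw [ht, inv_div, div_mul_eq_mul_div, div_le_iff₀ two_pos]; nlinarith
        linarith
  have hi : ∀ m v, v ≠ 0 → Integrable fun x => gaussianPDFReal m v x * u x := fun m v _ =>
    (integrable_gaussianPDFReal m v).mul_bdd (c := M) hu.aestronglyMeasurable
      (ae_of_all _ huM)
  rw [integral_gaussianReal_eq_integral_smul h₁, integral_gaussianReal_eq_integral_smul h₂]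
  simp only [smul_eq_mul]
  rw [← integral_sub (hi _ _ h₁) (hi _ _ h₂)]
  calc _ ≤ ∫ x, M * |p₁ x - p₂ x| := by
        rw [← Real.norm_eq_abs]
        refine norm_integral_le_of_norm_le ((hp₁.sub hp₂).abs.const_mul M) (ae_of_all _ fun x => ?_)
        rw [← sub_mul, norm_mul, mul_comm]
        exact mul_le_mul_of_nonneg_right (huM x) (abs_nonneg _)
    _ ≤ M * (2 * δ) := by
        rw [integral_const_mul]
        exact mul_le_mul_of_nonneg_left hL1 hM

end TotalVariation

section Comparison

open scoped NNReal

lemma integral_gaussianReal_eq (u : ℝ → ℝ) (hu : Measurable u) (m : ℝ) (v : ℝ≥0) :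
    ∫ y, u y ∂gaussianReal m v = ∫ y, u (m + y) ∂gaussianReal 0 v := by
  have := gaussianReal_map_const_add (μ := 0) (v := v) m
  rw [zero_add] at this
  rw [← this, integral_map (by fun_prop) hu.aestronglyMeasurable]

lemma measurable_integral_gaussianReal {u : ℝ → ℝ} (hu : Measurable u) (v : ℝ≥0) :
    Measurable fun m => ∫ y, u y ∂gaussianReal m v := by
  simp_rw [integral_gaussianReal_eq u hu]
  have h : Measurable fun p : ℝ × ℝ => u (p.1 + p.2) := by fun_prop
  exact (h.stronglyMeasurable.integral_prod_right' (ν := gaussianReal 0 v)).measurable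

lemma integrable_sq_gaussianReal (v : ℝ≥0) : Integrable (fun x : ℝ => x ^ 2) (gaussianReal 0 v) :=
  (memLp_id_gaussianReal' (μ := 0) (v := v) 2 (by simp)).integrable_sq

lemma integral_abs_gaussianReal_le (v : ℝ≥0) : ∫ x, |x| ∂gaussianReal 0 v ≤ √v := by
  have hsq : ∫ x, x ^ 2 ∂gaussianReal 0 v = v := by
    have := variance_fun_id_gaussianReal (μ := 0) (v := v)
    rw [variance_eq_integral (by fun_prop)] at this
    simpa using this
  have h := integral_mono_of_nonneg (μ := gaussianReal 0 v) (f := fun x => 2 * √v * |x|)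
    (g := fun x => x ^ 2 + v) (ae_of_all _ fun x => by positivity)
    ((integrable_sq_gaussianReal v).add (integrable_const _)) (ae_of_all _ fun x => by
      have := sq_sqrt v.coe_nonneg
      have := sq_nonneg (|x| - √v)
      simp only
      nlinarith [sq_abs x])
  rw [integral_const_mul, integral_add (integrable_sq_gaussianReal v) (integrable_const _), hsq]
    at h
  simp only [integral_const, probReal_univ, smul_eq_mul, one_mul] at h
  rcases eq_or_ne v 0 with rfl | hv
  · simp
  have hs : 0 < √(v : ℝ) := sqrt_pos.2 (NNReal.coe_pos.2 (pos_iff_ne_zero.2 hv))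
  have := sq_sqrt v.coe_nonneg
  nlinarith

variable {J : Type*} [Fintype J]

lemma measurable_dotProduct_left (a : J → ℝ) : Measurable fun g : J → ℝ => a ⬝ᵥ g := by
  simp only [dotProduct]; fun_prop

/-- Replacing a Gaussian linear form by another one inside a pair. -/
lemma abs_integral_mul_sub_le {a b b' : J → ℝ} {κ : ℝ} (hκ : 0 < κ) (ha : κ ≤ a ⬝ᵥ a)
    (hb' : κ ≤ b' ⬝ᵥ b' - (a ⬝ᵥ b') ^ 2 / a ⬝ᵥ a) {u : ℝ → ℝ} {M : ℝ}
    (hu : Measurable u) (huM : ∀ x, |u x| ≤ M) :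
    |∫ g, u (a ⬝ᵥ g) * (u (b ⬝ᵥ g) - u (b' ⬝ᵥ g)) ∂stdGauss J| ≤
      M ^ 2 / κ * (4 * |(b ⬝ᵥ b - (a ⬝ᵥ b) ^ 2 / a ⬝ᵥ a) -
        (b' ⬝ᵥ b' - (a ⬝ᵥ b') ^ 2 / a ⬝ᵥ a)| + 2 * |a ⬝ᵥ b - a ⬝ᵥ b'|) := by
  have hM : 0 ≤ M := (abs_nonneg _).trans (huM 0)
  have hα : 0 < a ⬝ᵥ a := hκ.trans_le ha
  have hma := measurable_dotProduct_left a
  have hi : ∀ c : J → ℝ, Integrable (fun g => u (a ⬝ᵥ g) * u (c ⬝ᵥ g)) (stdGauss J) := by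
    intro c
    have hmc := measurable_dotProduct_left c
    refine Integrable.of_bound (by fun_prop) (M * M) (ae_of_all _ fun g => ?_)
    rw [norm_mul]
    exact mul_le_mul (huM _) (huM _) (norm_nonneg _) hM
  simp_rw [mul_sub]
  rw [integral_sub (hi b) (hi b'), integral_dotProduct_pair hα hu hu huM huM,
    integral_dotProduct_pair hα hu hu huM huM]
  set v := b ⬝ᵥ b - (a ⬝ᵥ b) ^ 2 / a ⬝ᵥ a
  set v' := b' ⬝ᵥ b' - (a ⬝ᵥ b') ^ 2 / a ⬝ᵥ a
  set α := a ⬝ᵥ a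
  set c := a ⬝ᵥ b
  set c' := a ⬝ᵥ b'
  have hv' : 0 < v' := hκ.trans_le hb'
  have hv'0 : v'.toNNReal ≠ 0 := (Real.toNNReal_pos.2 hv').ne'
  have hj : ∀ (t : ℝ) (w : ℝ≥0), Integrable (fun x => u x * ∫ y, u y ∂gaussianReal (t * x) w)
      (gaussianReal 0 α.toNNReal) := by
    intro t w
    have h1 := (measurable_integral_gaussianReal hu w).comp (measurable_const_mul t)
    refine Integrable.of_bound (hu.mul h1).aestronglyMeasurable (M * M) (ae_of_all _ fun x => ?_)
    rw [norm_mul]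
    refine mul_le_mul (huM _) ?_ (norm_nonneg _) hM
    simpa using norm_integral_le_of_norm_le_const (μ := gaussianReal (t * x) w) (f := u) (C := M)
      (ae_of_all _ huM)
  rw [← integral_sub (hj _ _) (hj _ _), ← Real.norm_eq_abs]
  have habs : Integrable (fun x : ℝ => |x|) (gaussianReal 0 α.toNNReal) :=
    ((memLp_id_gaussianReal' (μ := 0) (v := α.toNNReal) 1 (by simp)).integrable le_rfl).abs
  have hdv : |(v.toNNReal : ℝ) - v'.toNNReal| ≤ |v - v'| := by
    rw [Real.coe_toNNReal', Real.coe_toNNReal']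
    exact abs_max_sub_max_le_abs _ _ _
  calc _ ≤ ∫ x, (M ^ 2 * (4 * (|v - v'| / κ)) + M ^ 2 * (2 * (|c - c'| / α / √κ)) * |x|)
        ∂gaussianReal 0 α.toNNReal := by
        refine norm_integral_le_of_norm_le ((integrable_const _).add (habs.const_mul _))
          (ae_of_all _ fun x => ?_)
        have h := abs_integral_gaussianReal_sub_le hu huM (c / α * x) (c' / α * x) v.toNNReal hv'0
        rw [← mul_sub, norm_mul]
        refine (mul_le_mul (huM x) h (abs_nonneg _) hM).trans ?_
        rw [← sub_mul, ← sub_div, abs_mul, abs_div, abs_of_pos hα]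
        have e1 : |(v.toNNReal : ℝ) - v'.toNNReal| / v'.toNNReal ≤ |v - v'| / κ := by
          rw [Real.coe_toNNReal v' hv'.le] at hdv ⊢
          gcongr
        have e2 : |c - c'| / α * |x| / √(v'.toNNReal : ℝ) ≤ |c - c'| / α / √κ * |x| := by
          rw [Real.coe_toNNReal v' hv'.le, div_mul_eq_mul_div _ (√κ)]
          gcongr
        calc _ ≤ M * (M * (4 * (|v - v'| / κ) + 2 * (|c - c'| / α / √κ * |x|))) := by gcongr
          _ = _ := by ring
    _ ≤ M ^ 2 * (4 * (|v - v'| / κ)) + M ^ 2 * (2 * (|c - c'| / α / √κ)) * √α := by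
        rw [integral_add (integrable_const _) (habs.const_mul _),
          integral_const_mul (M ^ 2 * (2 * (|c - c'| / α / √κ)))]
        simp only [integral_const, probReal_univ, smul_eq_mul, one_mul]
        have := integral_abs_gaussianReal_le α.toNNReal
        rw [Real.coe_toNNReal α hα.le] at this
        gcongr
    _ ≤ _ := by
        have e : |c - c'| / α / √κ * √α ≤ |c - c'| / κ := by
          have hsκ : 0 < √κ := sqrt_pos.2 hκ
          have hsα : 0 < √α := sqrt_pos.2 hα
          have hle : √κ ≤ √α := sqrt_le_sqrt ha
          have : |c - c'| / α / √κ * √α = |c - c'| / (√α * √κ) := by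
            nth_rewrite 1 [← mul_self_sqrt hα.le]
            field_simp
          have hκκ : κ ≤ √α * √κ := by
            nlinarith [mul_self_sqrt hκ.le]
          rw [this]
          gcongr
        calc _ = M ^ 2 * (4 * (|v - v'| / κ)) + M ^ 2 * (2 * (|c - c'| / α / √κ * √α)) := by ring
          _ ≤ M ^ 2 * (4 * (|v - v'| / κ)) + M ^ 2 * (2 * (|c - c'| / κ)) := by gcongr
          _ = _ := by ring

end Comparison

section Core

variable {ι S : Type*} [Fintype ι] [Fintype S]

lemma dotProduct_sq_le (a b : ι → ℝ) : (a ⬝ᵥ b) ^ 2 ≤ (a ⬝ᵥ a) * (b ⬝ᵥ b) := by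
  have := Finset.sum_mul_sq_le_sq_mul_sq Finset.univ a b
  simpa only [dotProduct, sq] using this

/-- Conditionally on the Gaussian field, two independent noises linearise the square. -/
lemma integral_sq_sub_gaussian (p : S → ℝ) (x : S → ι → ℝ) (m : ι → ℝ) {κ : ℝ} (hκ : 0 ≤ κ)
    {u : ℝ → ℝ} {M : ℝ} (hu : Measurable u) (huM : ∀ y, |u y| ≤ M) :
    ∫ g, (∑ s, p s * u (x s ⬝ᵥ g) - ∫ y, u y ∂gaussianReal (m ⬝ᵥ g) κ.toNNReal) ^ 2
        ∂stdGauss ι =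
      ∫ g, ∏ i : Fin 2, (∑ s, p s * u (Sum.elim (x s) 0 ⬝ᵥ g) -
        u (Sum.elim m (Pi.single i √κ) ⬝ᵥ g)) ∂stdGauss (ι ⊕ Fin 2) := by
  have hM : 0 ≤ M := (abs_nonneg _).trans (huM 0)
  have hmp := measurePreserving_sumPiEquivProdPi_symm
    (fun _ : ι ⊕ Fin 2 => gaussianReal 0 1)
  have hdot : ∀ (y : ι → ℝ) (z : Fin 2 → ℝ) (w : (ι → ℝ) × (Fin 2 → ℝ)),
      Sum.elim y z ⬝ᵥ (MeasurableEquiv.sumPiEquivProdPi (fun _ : ι ⊕ Fin 2 => ℝ)).symm w =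
        y ⬝ᵥ w.1 + z ⬝ᵥ w.2 := by
    intro y z w
    simp only [dotProduct, Fintype.sum_sum_type]
    rfl
  rw [← hmp.integral_comp' (g := fun g => ∏ i : Fin 2,
    (∑ s, p s * u (Sum.elim (x s) 0 ⬝ᵥ g) - u (Sum.elim m (Pi.single i √κ) ⬝ᵥ g)))]
  simp only [hdot, zero_dotProduct, add_zero, single_dotProduct]
  have hmeas : Measurable fun w : (ι → ℝ) × (Fin 2 → ℝ) => ∏ i : Fin 2,
      (∑ s, p s * u (x s ⬝ᵥ w.1) - u (m ⬝ᵥ w.1 + √κ * w.2 i)) := by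
    simp only [dotProduct]
    fun_prop
  rw [integral_prod]
  · refine integral_congr_ae (ae_of_all _ fun g => ?_)
    simp only
    rw [integral_fintype_prod_eq_prod (fun (_ : Fin 2) y =>
      ∑ s, p s * u (x s ⬝ᵥ g) - u (m ⬝ᵥ g + √κ * y))]
    rw [Fin.prod_univ_two, ← sq, integral_sub (integrable_const _)]
    · congr 2
      · simp
      · have := gaussianReal_map_const_mul (μ := 0) (v := 1) √κ
        have hv : NNReal.mk (√κ ^ 2) (sq_nonneg _) * 1 = κ.toNNReal := by
          ext; simp [sq_sqrt hκ, hκ]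
        rw [mul_zero, hv] at this
        rw [integral_gaussianReal_eq u hu, ← this, integral_map (by fun_prop)
          (Measurable.aestronglyMeasurable (by fun_prop))]
    · exact Integrable.of_bound (Measurable.aestronglyMeasurable (by fun_prop)) M
        (ae_of_all _ fun y => huM _)
  · refine Integrable.of_bound hmeas.aestronglyMeasurable
      (∏ i : Fin 2, (∑ s, |p s| * M + M)) (ae_of_all _ fun w => ?_)
    rw [Real.norm_eq_abs, Finset.abs_prod]
    refine Finset.prod_le_prod (fun _ _ => abs_nonneg _) fun i _ => ?_
    refine (abs_sub _ _).trans (add_le_add ((abs_sum_le_sum_abs _ _).trans ?_) (huM _))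
    refine Finset.sum_le_sum fun s _ => ?_
    rw [abs_mul]
    exact mul_le_mul_of_nonneg_left (huM _) (abs_nonneg _)

/-- Quantitative CLT for a mixture of Gaussian linear forms whose overlaps concentrate at `q`. -/
lemma integral_sq_mixture_sub_gaussian_le {p : S → ℝ} (hp : ∀ s, 0 ≤ p s) (hp1 : ∑ s, p s = 1)
    {x : S → ι → ℝ} (hx : ∀ s, x s ⬝ᵥ x s = 1) {q : ℝ} (hq0 : 0 ≤ q) (hq1 : q < 1)
    {u : ℝ → ℝ} {M : ℝ} (hu : Measurable u) (huM : ∀ y, |u y| ≤ M) :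
    ∫ g, (∑ s, p s * u (x s ⬝ᵥ g) -
        ∫ y, u y ∂gaussianReal ((∑ s, p s • x s) ⬝ᵥ g) (1 - q).toNNReal) ^ 2 ∂stdGauss ι ≤
      48 * M ^ 2 / (1 - q) ^ 2 * ∑ s, ∑ t, p s * p t * |x s ⬝ᵥ x t - q| := by
  have hM : 0 ≤ M := (abs_nonneg _).trans (huM 0)
  set m : ι → ℝ := ∑ s, p s • x s with hm
  set D := ∑ s, ∑ t, p s * p t * |x s ⬝ᵥ x t - q| with hD
  obtain ⟨κ, hκ⟩ : ∃ κ, κ = 1 - q := ⟨_, rfl⟩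
  rw [← hκ]
  have hκ0 : 0 < κ := by linarith
  have hκ1 : κ ≤ 1 := by linarith
  set Q := m ⬝ᵥ m with hQ
  have hρ : ∀ s, x s ⬝ᵥ m = ∑ t, p t * (x s ⬝ᵥ x t) := by
    intro s
    simp [hm, dotProduct_sum, dotProduct_smul]
  have hQρ : Q = ∑ s, p s * (x s ⬝ᵥ m) := by
    rw [hQ]
    nth_rewrite 1 [hm]
    simp [sum_dotProduct, smul_dotProduct]
  have hR : ∀ s t, |x s ⬝ᵥ x t| ≤ 1 := by
    intro s t
    rw [abs_le_one_iff_mul_self_le_one]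
    have := dotProduct_sq_le (x s) (x t)
    rw [hx, hx] at this
    nlinarith
  have hρQ : ∀ s, (x s ⬝ᵥ m) ^ 2 ≤ Q := by
    intro s
    have := dotProduct_sq_le (x s) m
    rwa [hx, one_mul] at this
  have hρ1 : ∀ s, |x s ⬝ᵥ m| ≤ 1 := by
    intro s
    rw [hρ]
    calc _ ≤ ∑ t, |p t * (x s ⬝ᵥ x t)| := abs_sum_le_sum_abs _ _
      _ ≤ ∑ t, p t := Finset.sum_le_sum fun t _ => by
        rw [abs_mul, abs_of_nonneg (hp t)]
        exact mul_le_of_le_one_right (hp t) (hR s t)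
      _ = 1 := hp1
  have hQ0 : 0 ≤ Q := by
    rw [hQ, dotProduct]; exact Finset.sum_nonneg fun i _ => mul_self_nonneg _
  have hQ1 : Q ≤ 1 := by
    rw [hQρ, ← hp1]
    exact Finset.sum_le_sum fun s _ =>
      mul_le_of_le_one_right (hp s) ((le_abs_self _).trans (hρ1 s))
  have hρq : ∀ s, |x s ⬝ᵥ m - q| ≤ ∑ t, p t * |x s ⬝ᵥ x t - q| := by
    intro s
    have : x s ⬝ᵥ m - q = ∑ t, p t * (x s ⬝ᵥ x t - q) := by
      simp_rw [mul_sub, Finset.sum_sub_distrib, ← Finset.sum_mul, hp1, one_mul, hρ]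
    rw [this]
    refine (abs_sum_le_sum_abs _ _).trans_eq ?_
    simp_rw [abs_mul, abs_of_nonneg (hp _)]
  have hDρ : ∑ s, p s * |x s ⬝ᵥ m - q| ≤ D := by
    rw [hD]
    refine Finset.sum_le_sum fun s _ => ?_
    simp_rw [mul_assoc, ← Finset.mul_sum]
    exact mul_le_mul_of_nonneg_left (hρq s) (hp s)
  have hDQ : |Q - q| ≤ D := by
    have : Q - q = ∑ s, p s * (x s ⬝ᵥ m - q) := by
      simp_rw [mul_sub, Finset.sum_sub_distrib, ← Finset.sum_mul, hp1, one_mul, hQρ]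
    rw [this]
    refine (abs_sum_le_sum_abs _ _).trans (le_trans (le_of_eq ?_) hDρ)
    simp_rw [abs_mul, abs_of_nonneg (hp _)]
  have hD0 : 0 ≤ D := (abs_nonneg _).trans hDQ
  rw [integral_sq_sub_gaussian p x m hκ0.le hu huM]
  set X : S → ι ⊕ Fin 2 → ℝ := fun s => Sum.elim (x s) 0 with hX
  set Y : Fin 2 → ι ⊕ Fin 2 → ℝ := fun i => Sum.elim m (Pi.single i √κ) with hY
  have dXX : ∀ s t, X s ⬝ᵥ X t = x s ⬝ᵥ x t := fun s t => by simp [hX]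
  have dXY : ∀ s i, X s ⬝ᵥ Y i = x s ⬝ᵥ m := fun s i => by simp [hX, hY]
  have dYX : ∀ s i, Y i ⬝ᵥ X s = x s ⬝ᵥ m := fun s i => by rw [dotProduct_comm, dXY]
  have dYY : ∀ i, Y i ⬝ᵥ Y i = Q + κ := fun i => by simp [hY, hQ, hκ0.le]
  have dYY' : Y 0 ⬝ᵥ Y 1 = Q := by simp [hY, hQ]
  have b1 : ∀ s t, |∫ g, u (X s ⬝ᵥ g) * (u (X t ⬝ᵥ g) - u (Y 1 ⬝ᵥ g)) ∂stdGauss (ι ⊕ Fin 2)| ≤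
      M ^ 2 / κ * (4 * |Q - q| + 10 * |x s ⬝ᵥ x t - q| + 10 * |x s ⬝ᵥ m - q|) := by
    intro s t
    refine (abs_integral_mul_sub_le hκ0 (by rw [dXX, hx]; exact hκ1) ?_ hu huM).trans ?_
    · rw [dYY, dXY, dXX, hx, div_one]; linarith [hρQ s]
    · simp only [dXX, dXY, dYY, hx, div_one]
      have h1 : |x s ⬝ᵥ x t - x s ⬝ᵥ m| ≤ |x s ⬝ᵥ x t - q| + |x s ⬝ᵥ m - q| := by
        rw [abs_sub_comm (x s ⬝ᵥ m)]; exact abs_sub_le _ _ _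
      have h2 : |1 - (x s ⬝ᵥ x t) ^ 2 - (Q + κ - (x s ⬝ᵥ m) ^ 2)| ≤
          |Q - q| + 2 * |x s ⬝ᵥ x t - x s ⬝ᵥ m| := by
        have : 1 - (x s ⬝ᵥ x t) ^ 2 - (Q + κ - (x s ⬝ᵥ m) ^ 2) =
          -(Q - q) - (x s ⬝ᵥ x t + x s ⬝ᵥ m) * (x s ⬝ᵥ x t - x s ⬝ᵥ m) := by rw [hκ]; ring
        rw [this]
        refine (abs_sub _ _).trans ?_
        rw [abs_neg, abs_mul]
        gcongr
        exact (abs_add_le _ _).trans (by linarith [hR s t, hρ1 s])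
      refine mul_le_mul_of_nonneg_left ?_ (by positivity)
      linarith
  have b2 : ∀ s, |∫ g, u (Y 0 ⬝ᵥ g) * (u (X s ⬝ᵥ g) - u (Y 1 ⬝ᵥ g)) ∂stdGauss (ι ⊕ Fin 2)| ≤
      M ^ 2 / κ * (4 * |Q - q| + 10 / κ * (|x s ⬝ᵥ m - q| + |Q - q|)) := by
    intro s
    have hα : 0 < Q + κ := by linarith
    refine (abs_integral_mul_sub_le hκ0 (by rw [dYY]; linarith) ?_ hu huM).trans ?_
    · rw [dYY, dYY, dYY']
      have : Q + κ - Q ^ 2 / (Q + κ) = κ + κ * (Q / (Q + κ)) := by field_simp; ring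
      rw [this]
      have : 0 ≤ κ * (Q / (Q + κ)) := by positivity
      linarith
    · simp only [dXX, dYX, dYY, dYY', hx]
      have h1 : |x s ⬝ᵥ m - Q| ≤ |x s ⬝ᵥ m - q| + |Q - q| := by
        rw [abs_sub_comm Q]; exact abs_sub_le _ _ _
      have h2 : |1 - (x s ⬝ᵥ m) ^ 2 / (Q + κ) - (Q + κ - Q ^ 2 / (Q + κ))| ≤
          |Q - q| + 2 / κ * |x s ⬝ᵥ m - Q| := by
        have : 1 - (x s ⬝ᵥ m) ^ 2 / (Q + κ) - (Q + κ - Q ^ 2 / (Q + κ)) =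
          -(Q - q) - (x s ⬝ᵥ m + Q) / (Q + κ) * (x s ⬝ᵥ m - Q) := by
            field_simp; rw [hκ]; ring
        rw [this]
        refine (abs_sub _ _).trans ?_
        rw [abs_neg, abs_mul, abs_div, abs_of_pos hα]
        gcongr
        · refine (abs_add_le _ _).trans ?_
          rw [abs_of_nonneg hQ0]; linarith [hρ1 s]
        · linarith
      have h3 : 2 * |x s ⬝ᵥ m - Q| ≤ 2 / κ * |x s ⬝ᵥ m - Q| := by
        gcongr
        rw [le_div_iff₀ hκ0]; linarith
      refine mul_le_mul_of_nonneg_left ?_ (by positivity)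
      calc _ ≤ 4 * (|Q - q| + 2 / κ * |x s ⬝ᵥ m - Q|) + 2 / κ * |x s ⬝ᵥ m - Q| := by linarith
        _ = 4 * |Q - q| + 10 / κ * |x s ⬝ᵥ m - Q| := by ring
        _ ≤ _ := by gcongr
  have hexpand : ∀ g : ι ⊕ Fin 2 → ℝ,
      ∏ i : Fin 2, (∑ s, p s * u (X s ⬝ᵥ g) - u (Y i ⬝ᵥ g)) =
      ∑ s, ∑ t, p s * p t * (u (X s ⬝ᵥ g) * (u (X t ⬝ᵥ g) - u (Y 1 ⬝ᵥ g))) -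
        ∑ s, p s * (u (Y 0 ⬝ᵥ g) * (u (X s ⬝ᵥ g) - u (Y 1 ⬝ᵥ g))) := by
    intro g
    have e : ∑ t, p t * u (X t ⬝ᵥ g) - u (Y 1 ⬝ᵥ g) =
        ∑ t, p t * (u (X t ⬝ᵥ g) - u (Y 1 ⬝ᵥ g)) := by
      simp_rw [mul_sub, Finset.sum_sub_distrib, ← Finset.sum_mul, hp1, one_mul]
    rw [Fin.prod_univ_two, sub_mul, e, Finset.sum_mul_sum, Finset.mul_sum]
    congr 1
    · exact Finset.sum_congr rfl fun s _ => Finset.sum_congr rfl fun t _ => by ring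
    · exact Finset.sum_congr rfl fun s _ => by ring
  have hint : ∀ a b c : ι ⊕ Fin 2 → ℝ, Integrable (fun g => u (a ⬝ᵥ g) * (u (b ⬝ᵥ g) - u (c ⬝ᵥ g)))
      (stdGauss (ι ⊕ Fin 2)) := by
    intro a b c
    have ha := measurable_dotProduct_left a
    have hb := measurable_dotProduct_left b
    have hc := measurable_dotProduct_left c
    refine Integrable.of_bound (Measurable.aestronglyMeasurable (by fun_prop)) (M * (M + M))
      (ae_of_all _ fun g => ?_)
    rw [norm_mul]
    exact mul_le_mul (huM _) ((abs_sub _ _).trans (add_le_add (huM _) (huM _))) (norm_nonneg _) hM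
  calc _ = ∑ s, ∑ t, p s * p t *
        (∫ g, u (X s ⬝ᵥ g) * (u (X t ⬝ᵥ g) - u (Y 1 ⬝ᵥ g)) ∂stdGauss (ι ⊕ Fin 2)) -
        ∑ s, p s * ∫ g, u (Y 0 ⬝ᵥ g) * (u (X s ⬝ᵥ g) - u (Y 1 ⬝ᵥ g)) ∂stdGauss (ι ⊕ Fin 2) := by
        refine (integral_congr_ae (ae_of_all _ hexpand)).trans ?_
        rw [integral_sub, integral_finsetSum, integral_finsetSum]
        · simp_rw [integral_const_mul]
          congr 1
          refine Finset.sum_congr rfl fun s _ => ?_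
          rw [integral_finsetSum _ fun t _ => (hint _ _ _).const_mul _]
          simp_rw [integral_const_mul]
        · exact fun s _ => (hint _ _ _).const_mul _
        · exact fun s _ => integrable_finsetSum _ fun t _ => (hint _ _ _).const_mul _
        · exact integrable_finsetSum _ fun s _ => integrable_finsetSum _ fun t _ =>
            (hint _ _ _).const_mul _
        · exact integrable_finsetSum _ fun s _ => (hint _ _ _).const_mul _
    _ ≤ ∑ s, ∑ t, p s * p t *
        (M ^ 2 / κ * (4 * |Q - q| + 10 * |x s ⬝ᵥ x t - q| + 10 * |x s ⬝ᵥ m - q|)) +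
        ∑ s, p s * (M ^ 2 / κ * (4 * |Q - q| + 10 / κ * (|x s ⬝ᵥ m - q| + |Q - q|))) := by
        rw [sub_eq_add_neg, ← Finset.sum_neg_distrib]
        refine add_le_add (Finset.sum_le_sum fun s _ => Finset.sum_le_sum fun t _ => ?_)
          (Finset.sum_le_sum fun s _ => ?_)
        · exact mul_le_mul_of_nonneg_left ((le_abs_self _).trans (b1 s t))
            (mul_nonneg (hp s) (hp t))
        · rw [← mul_neg]
          exact mul_le_mul_of_nonneg_left ((neg_le_abs _).trans (b2 s)) (hp s)
    _ = M ^ 2 / κ * (4 * |Q - q| + 10 * D + 10 * ∑ s, p s * |x s ⬝ᵥ m - q|) +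
        M ^ 2 / κ * (4 * |Q - q| + 10 / κ * (∑ s, p s * |x s ⬝ᵥ m - q| + |Q - q|)) := by
        congr 1
        · have e : ∀ s t, p s * p t * (M ^ 2 / κ * (4 * |Q - q| + 10 * |x s ⬝ᵥ x t - q| +
              10 * |x s ⬝ᵥ m - q|)) = M ^ 2 / κ * (4 * |Q - q|) * p s * p t +
              M ^ 2 / κ * 10 * (p s * p t * |x s ⬝ᵥ x t - q|) +
              M ^ 2 / κ * 10 * (p s * |x s ⬝ᵥ m - q|) * p t := fun s t => by ring
          simp_rw [e, Finset.sum_add_distrib, ← Finset.mul_sum, hp1, mul_one, ← Finset.mul_sum,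
            hp1]
          rw [← hD]; ring
        · have e : ∀ s, p s * (M ^ 2 / κ * (4 * |Q - q| + 10 / κ * (|x s ⬝ᵥ m - q| + |Q - q|))) =
              M ^ 2 / κ * (4 * |Q - q| + 10 / κ * |Q - q|) * p s +
              M ^ 2 / κ * (10 / κ) * (p s * |x s ⬝ᵥ m - q|) := fun s => by ring
          simp_rw [e, Finset.sum_add_distrib, ← Finset.mul_sum, hp1]
          ring
    _ ≤ M ^ 2 / κ * (4 * D + 10 * D + 10 * D) + M ^ 2 / κ * (4 * D + 10 / κ * (D + D)) := by
        gcongr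
    _ ≤ M ^ 2 / κ * (24 / κ * D) + M ^ 2 / κ * (4 / κ * D + 10 / κ * (D + D)) := by
        have : ∀ c : ℝ, 0 ≤ c → c ≤ c / κ := fun c hc => by
          rw [le_div_iff₀ hκ0]; nlinarith
        have h24 := mul_le_mul_of_nonneg_right (this 24 (by norm_num)) hD0
        have h4 := mul_le_mul_of_nonneg_right (this 4 (by norm_num)) hD0
        gcongr
        linarith
    _ = 48 * M ^ 2 / κ ^ 2 * D := by
        field_simp; ring

end Core

section ExponentialMoments

variable {J S : Type*} [Fintype J] [Fintype S]

lemma integrable_exp_dotProduct (b : J → ℝ) :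
    Integrable (fun g => exp (b ⬝ᵥ g)) (stdGauss J) := by
  have h := integrable_exp_mul_gaussianReal (μ := 0) (v := (b ⬝ᵥ b).toNNReal) 1
  rw [← map_dotProduct b, integrable_map_measure (by fun_prop)
    (measurable_dotProduct_left b).aemeasurable] at h
  simpa [Function.comp_def] using h

lemma integral_exp_dotProduct (b : J → ℝ) :
    ∫ g, exp (b ⬝ᵥ g) ∂stdGauss J = exp (b ⬝ᵥ b / 2) := by
  have h := mgf_gaussianReal (map_dotProduct b) 1
  have hb : 0 ≤ b ⬝ᵥ b := Finset.sum_nonneg fun i _ => mul_self_nonneg _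
  simpa [mgf, hb] using h

lemma indepFun_restrict_stdGauss {T U : Finset J} (hTU : Disjoint T U) :
    IndepFun (fun (g : J → ℝ) (i : T) => g i) (fun (g : J → ℝ) (i : U) => g i) (stdGauss J) :=
  iIndepFun.indepFun_finset T U hTU
    (iIndepFun_pi (X := fun _ x => x) fun _ => aemeasurable_id) fun i => measurable_pi_apply i

lemma dotProduct_eq_sum_coe {T : Finset J} {a : J → ℝ} (ha : ∀ i ∉ T, a i = 0) (g : J → ℝ) :
    a ⬝ᵥ g = ∑ i : T, a i * g i := by
  rw [Finset.sum_coe_sort T (fun i => a i * g i), dotProduct]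
  exact (Finset.sum_subset (Finset.subset_univ T) fun i _ hi => by rw [ha i hi, zero_mul]).symm

/-- A Gaussian field independent of a random probability weight tilts it by at most its
exponential moment. -/
lemma integral_tilt_le [Nonempty S] {T U : Finset J} (hTU : Disjoint T U) {w : S → ℝ}
    (hw : ∀ s, 0 < w s) {a b : S → J → ℝ} (ha : ∀ s, ∀ i ∉ T, a s i = 0)
    (hb : ∀ s, ∀ i ∉ U, b s i = 0) {v : ℝ} (hv : ∀ s, b s ⬝ᵥ b s ≤ v) :
    Integrable (fun g => ∑ s, w s * exp (a s ⬝ᵥ g) / (∑ t, w t * exp (a t ⬝ᵥ g)) *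
      exp (b s ⬝ᵥ g)) (stdGauss J) ∧
    ∫ g, ∑ s, w s * exp (a s ⬝ᵥ g) / (∑ t, w t * exp (a t ⬝ᵥ g)) * exp (b s ⬝ᵥ g) ∂stdGauss J ≤
      exp (v / 2) := by
  have hS : ∀ g : J → ℝ, 0 < ∑ t, w t * exp (a t ⬝ᵥ g) := fun g =>
    Finset.sum_pos (fun t _ => mul_pos (hw t) (exp_pos _)) Finset.univ_nonempty
  have hma := fun s => measurable_dotProduct_left (a s)
  have hν : ∀ s, Integrable (fun g => w s * exp (a s ⬝ᵥ g) / (∑ t, w t * exp (a t ⬝ᵥ g)))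
      (stdGauss J) := by
    intro s
    refine Integrable.of_bound (Measurable.aestronglyMeasurable (by fun_prop)) 1
      (ae_of_all _ fun g => ?_)
    rw [Real.norm_eq_abs, abs_of_nonneg (div_nonneg (mul_pos (hw s) (exp_pos _)).le (hS g).le)]
    refine div_le_one_of_le₀ ?_ (hS g).le
    exact Finset.single_le_sum (f := fun t => w t * exp (a t ⬝ᵥ g))
      (fun t _ => (mul_pos (hw t) (exp_pos _)).le) (Finset.mem_univ s)
  have hind : ∀ s, IndepFun (fun g => w s * exp (a s ⬝ᵥ g) / (∑ t, w t * exp (a t ⬝ᵥ g)))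
      (fun g => exp (b s ⬝ᵥ g)) (stdGauss J) := by
    intro s
    have := (indepFun_restrict_stdGauss hTU).comp
      (φ := fun y : T → ℝ => w s * exp (∑ i : T, a s i * y i) /
        (∑ t, w t * exp (∑ i : T, a t i * y i)))
      (ψ := fun y : U → ℝ => exp (∑ i : U, b s i * y i)) (by fun_prop) (by fun_prop)
    simp_rw [dotProduct_eq_sum_coe (ha _), dotProduct_eq_sum_coe (hb _)]
    exact this
  have hterm : ∀ s, Integrable (fun g => w s * exp (a s ⬝ᵥ g) / (∑ t, w t * exp (a t ⬝ᵥ g)) *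
      exp (b s ⬝ᵥ g)) (stdGauss J) := fun s =>
    (hind s).integrable_mul (hν s) (integrable_exp_dotProduct (b s))
  refine ⟨integrable_finsetSum _ fun s _ => hterm s, ?_⟩
  rw [integral_finsetSum _ fun s _ => hterm s]
  calc _ ≤ ∑ s, (∫ g, w s * exp (a s ⬝ᵥ g) / (∑ t, w t * exp (a t ⬝ᵥ g)) ∂stdGauss J) *
        exp (v / 2) := by
        refine Finset.sum_le_sum fun s _ => ?_
        rw [(hind s).integral_fun_mul_eq_mul_integral (hν s).aestronglyMeasurable
          (integrable_exp_dotProduct (b s)).aestronglyMeasurable, integral_exp_dotProduct]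
        have := hv s
        refine mul_le_mul_of_nonneg_left (by gcongr) (integral_nonneg fun g => ?_)
        exact div_nonneg (mul_pos (hw s) (exp_pos _)).le (hS g).le
    _ = exp (v / 2) := by
        rw [← Finset.sum_mul, ← integral_finsetSum _ fun s _ => hν s]
        simp_rw [← Finset.sum_div, div_self (hS _).ne']
        simp

end ExponentialMoments

lemma spin_mul_self (b : Bool) : spin b * spin b = 1 := by cases b <;> simp [spin]

lemma abs_spin (b : Bool) : |spin b| = 1 := by cases b <;> simp [spin]

lemma spin_not (b : Bool) : spin (!b) = -spin b := by cases b <;> simp [spin]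

section Gibbs

variable {N : ℕ} (β h : ℝ)

lemma Zpart_pos (G : Disorder N) : 0 < Zpart β h G :=
  Finset.sum_pos (fun _ _ => exp_pos _) Finset.univ_nonempty

lemma gibbs_nonneg (G : Disorder N) (σ : Config N) : 0 ≤ gibbs β h G σ :=
  div_nonneg (exp_pos _).le (Zpart_pos β h G).le

lemma sum_gibbs (G : Disorder N) : ∑ σ, gibbs β h G σ = 1 := by
  simp_rw [gibbs, ← Finset.sum_div]
  exact div_self (Zpart_pos β h G).ne'

lemma measurable_gibbs (σ : Config N) : Measurable fun G => gibbs β h G σ := by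
  unfold gibbs Zpart ham
  fun_prop

/-- Reversal of the spin at site `i`. -/
def flipAt (i : Fin N) (σ : Config N) : Config N := Function.update σ i (!σ i)

lemma flipAt_involutive (i : Fin N) : Function.Involutive (flipAt i) := fun σ => by
  ext j
  by_cases hj : j = i
  · subst hj; simp [flipAt]
  · simp [flipAt, hj]

lemma spin_flipAt_self (i : Fin N) (σ : Config N) : spin (flipAt i σ i) = -spin (σ i) := by
  simp [flipAt, spin_not]

lemma flipAt_of_ne {i j : Fin N} (hj : j ≠ i) (σ : Config N) : flipAt i σ j = σ j := by
  simp [flipAt, hj]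

lemma sum_spin_mul_eq_zero (i : Fin N) {F : Config N → ℝ} (hF : ∀ σ, F (flipAt i σ) = F σ) :
    ∑ σ, spin (σ i) * F σ = 0 := by
  have := (flipAt_involutive i).toPerm.sum_comp Finset.univ (fun σ => spin (σ i) * F σ) (by simp)
  simp only [Function.Involutive.coe_toPerm, spin_flipAt_self, hF, neg_mul,
    Finset.sum_neg_distrib] at this
  linarith

/-- If the Hamiltonian splits into an even and an odd part in the spin `i`, the conditional
variance of that spin is controlled by the partition function of the even part. -/
lemma sq_sum_exp_le (G : Disorder N) (i : Fin N) {A Y : Config N → ℝ}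
    (hham : ∀ σ, ham β h G σ = A σ + Y σ) (hA : ∀ σ, A (flipAt i σ) = A σ)
    (hY : ∀ σ, Y (flipAt i σ) = -Y σ) :
    (∑ σ, exp (A σ)) ^ 2 ≤ Zpart β h G ^ 2 * (1 - mavg β h G i ^ 2) := by
  have hZ := Zpart_pos β h G
  have hm : Zpart β h G * mavg β h G i = ∑ σ, spin (σ i) * exp (A σ + Y σ) := by
    simp only [mavg, qavg, gibbs, Finset.mul_sum, hham]
    exact Finset.sum_congr rfl fun σ _ => by field_simp
  have hZ' : Zpart β h G = ∑ σ, exp (A σ + Y σ) := by simp only [Zpart, hham]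
  have key : ∀ ε : ℝ, ε * ε = 1 → Zpart β h G * (1 + ε * mavg β h G i) =
      ∑ σ, exp (A σ + ε * (spin (σ i) * Y σ)) := by
    intro ε hε
    have h0 := sum_spin_mul_eq_zero i (F := fun σ => exp (A σ + ε * (spin (σ i) * Y σ)))
      fun σ => by simp only [hA, hY, spin_flipAt_self, neg_mul_neg]
    have : Zpart β h G * (1 + ε * mavg β h G i) = ∑ σ, exp (A σ + ε * (spin (σ i) * Y σ)) +
        ε * ∑ σ, spin (σ i) * exp (A σ + ε * (spin (σ i) * Y σ)) := by
      rw [mul_add, mul_one, mul_left_comm, hm, hZ', Finset.mul_sum, Finset.mul_sum,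
        ← Finset.sum_add_distrib, ← Finset.sum_add_distrib]
      refine Finset.sum_congr rfl fun σ _ => ?_
      rcases mul_self_eq_one_iff.1 hε with rfl | rfl <;>
        rcases mul_self_eq_one_iff.1 (spin_mul_self (σ i)) with hs | hs <;> simp [hs]
    rw [this, h0, mul_zero, add_zero]
  have hp := key 1 (by norm_num)
  have hn := key (-1) (by norm_num)
  have e : Zpart β h G ^ 2 * (1 - mavg β h G i ^ 2) =
      (Zpart β h G * (1 + 1 * mavg β h G i)) * (Zpart β h G * (1 + -1 * mavg β h G i)) := by ring
  rw [e, hp, hn]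
  have e1 : ∀ σ, exp (A σ) = exp ((A σ + 1 * (spin (σ i) * Y σ)) / 2) *
      exp ((A σ + -1 * (spin (σ i) * Y σ)) / 2) := fun σ => by
    rw [← exp_add]
    ring_nf
  have e2 : ∀ x : ℝ, exp x = exp (x / 2) ^ 2 := fun x => by
    rw [← exp_nat_mul]
    ring_nf
  rw [Finset.sum_congr rfl fun σ _ => e1 σ,
    Finset.sum_congr rfl fun σ _ => e2 (A σ + 1 * (spin (σ i) * Y σ)),
    Finset.sum_congr rfl fun σ _ => e2 (A σ + -1 * (spin (σ i) * Y σ))]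
  exact Finset.sum_mul_sq_le_sq_mul_sq Finset.univ _ _

end Gibbs

section LowerBound

variable {N : ℕ} (β h : ℝ)

instance : IsProbabilityMeasure (μdis N) := by
  unfold μdis
  infer_instance

/-- Bonds containing the site `i`. -/
abbrev Touches (i : Fin N) (p : Pairs N) : Prop := p.1.1 = i ∨ p.1.2 = i

/-- Couplings of the configuration `σ` over the bonds satisfying `P`. -/
noncomputable def bondVec (P : Pairs N → Prop) [DecidablePred P] (σ : Config N) : Disorder N :=
  fun p => if P p then β / √N * (spin (σ p.1.1) * spin (σ p.1.2)) else 0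

lemma ham_eq_split (G : Disorder N) (i : Fin N) (σ : Config N) :
    ham β h G σ = (bondVec β (fun p => ¬ Touches i p) σ ⬝ᵥ G +
      h * ∑ j ∈ univ.erase i, spin (σ j)) + (bondVec β (Touches i) σ ⬝ᵥ G + h * spin (σ i)) := by
  have h1 : bondVec β (fun p => ¬ Touches i p) σ ⬝ᵥ G + bondVec β (Touches i) σ ⬝ᵥ G =
      (β / √N) * ∑ p : Pairs N, G p * spin (σ p.1.1) * spin (σ p.1.2) := by
    simp only [dotProduct, bondVec, Finset.mul_sum, ← Finset.sum_add_distrib]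
    refine Finset.sum_congr rfl fun p _ => ?_
    by_cases hp : Touches i p <;> simp only [hp, not_true_eq_false, not_false_eq_true, if_true,
      if_false] <;> ring
  rw [ham, ← h1, ← Finset.add_sum_erase univ (fun j => spin (σ j)) (Finset.mem_univ i)]
  ring

lemma bondVec_not_touches_flipAt (i : Fin N) (σ : Config N) :
    bondVec β (fun p => ¬ Touches i p) (flipAt i σ) = bondVec β (fun p => ¬ Touches i p) σ := by
  ext p
  simp only [bondVec]
  split_ifs with hp
  · rfl
  · rw [flipAt_of_ne (fun e => hp (Or.inl e)), flipAt_of_ne (fun e => hp (Or.inr e))]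

lemma bondVec_touches_flipAt (i : Fin N) (σ : Config N) :
    bondVec β (Touches i) (flipAt i σ) = -bondVec β (Touches i) σ := by
  ext p
  simp only [bondVec, Pi.neg_apply]
  split_ifs with hp
  · obtain ⟨⟨j, k⟩, hjk⟩ := p
    rcases hp with hp | hp <;> simp only at hp hjk <;> subst hp
    · rw [spin_flipAt_self, flipAt_of_ne hjk.ne']; ring
    · rw [spin_flipAt_self, flipAt_of_ne hjk.ne]; ring
  · simp

lemma bondVec_touches_dotProduct_self_le (i : Fin N) (σ : Config N) :
    bondVec β (Touches i) σ ⬝ᵥ bondVec β (Touches i) σ ≤ 2 * β ^ 2 := by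
  have hN : (0 : ℝ) < N := by exact_mod_cast i.pos
  have hcard : #(univ.filter fun p : Pairs N => Touches i p) ≤ 2 * N := by
    rw [Finset.filter_or, two_mul]
    refine (Finset.card_union_le _ _).trans (add_le_add ?_ ?_)
    · refine (Finset.card_le_card_of_injOn (t := (univ : Finset (Fin N))) (fun p => p.1.2)
        (fun _ _ => Finset.mem_coe.2 (Finset.mem_univ _)) ?_).trans_eq (by simp)
      intro p hp p' hp' e
      simp only [coe_filter, mem_univ, true_and, Set.mem_ofPred_eq] at hp hp'
      exact Subtype.ext (Prod.ext (hp.trans hp'.symm) e)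
    · refine (Finset.card_le_card_of_injOn (t := (univ : Finset (Fin N))) (fun p => p.1.1)
        (fun _ _ => Finset.mem_coe.2 (Finset.mem_univ _)) ?_).trans_eq (by simp)
      intro p hp p' hp' e
      simp only [coe_filter, mem_univ, true_and, Set.mem_ofPred_eq] at hp hp'
      exact Subtype.ext (Prod.ext e (hp.trans hp'.symm))
  have hterm : ∀ p, bondVec β (Touches i) σ p * bondVec β (Touches i) σ p =
      if Touches i p then β ^ 2 / N else 0 := by
    intro p
    simp only [bondVec]
    split_ifs
    · have : β / √N * (spin (σ p.1.1) * spin (σ p.1.2)) * (β / √N * (spin (σ p.1.1) *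
          spin (σ p.1.2))) = β ^ 2 / (√N * √N) * ((spin (σ p.1.1) * spin (σ p.1.1)) *
          (spin (σ p.1.2) * spin (σ p.1.2))) := by
        field_simp
      rw [this, spin_mul_self, spin_mul_self, mul_self_sqrt hN.le]; ring
    · simp
  simp only [dotProduct, hterm]
  rw [← Finset.sum_filter, Finset.sum_const, nsmul_eq_mul]
  calc _ ≤ ((2 * N : ℕ) : ℝ) * (β ^ 2 / N) := by gcongr
    _ = 2 * β ^ 2 := by push_cast; field_simp

lemma tangent_le_inv_sq {x a : ℝ} (hx : 0 < x) (ha : 0 < a) :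
    3 / a ^ 2 - 2 * x / a ^ 3 ≤ 1 / x ^ 2 := by
  have : 1 / x ^ 2 - (3 / a ^ 2 - 2 * x / a ^ 3) = (a - x) ^ 2 * (a + 2 * x) / (x ^ 2 * a ^ 3) := by
    field_simp; ring
  have h2 : 0 ≤ (a - x) ^ 2 * (a + 2 * x) / (x ^ 2 * a ^ 3) := by positivity
  linarith

lemma abs_mavg_le_one (G : Disorder N) (i : Fin N) : |mavg β h G i| ≤ 1 := by
  rw [← sum_gibbs β h G]
  refine (abs_sum_le_sum_abs _ _).trans (Finset.sum_le_sum fun σ _ => ?_)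
  rw [abs_mul, abs_spin, one_mul, abs_of_nonneg (gibbs_nonneg β h G σ)]

lemma measurable_mavg (i : Fin N) : Measurable fun G => mavg β h G i := by
  have := measurable_gibbs (N := N) β h
  unfold mavg qavg
  fun_prop

lemma integrable_sq_mavg (i : Fin N) : Integrable (fun G => mavg β h G i ^ 2) (μdis N) := by
  refine Integrable.of_bound ((measurable_mavg β h i).pow_const 2).aestronglyMeasurable 1
    (ae_of_all _ fun G => ?_)
  rw [norm_pow]
  exact pow_le_one₀ (norm_nonneg _) (abs_mavg_le_one β h G i)

/-- A single spin keeps a positive averaged conditional variance, uniformly in the size. -/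
lemma integral_sq_mavg_le (i : Fin N) :
    ∫ G, mavg β h G i ^ 2 ∂μdis N ≤ 1 - exp (-(2 * (β ^ 2 + |h|))) := by
  set a := bondVec β (fun p => ¬ Touches i p) with ha
  set b := bondVec β (Touches i) with hb
  set w : Config N → ℝ := fun σ => exp (h * ∑ j ∈ univ.erase i, spin (σ j)) with hw
  set W : Disorder N → ℝ := fun G =>
    ∑ σ, w σ * exp (a σ ⬝ᵥ G) / (∑ τ, w τ * exp (a τ ⬝ᵥ G)) * exp (b σ ⬝ᵥ G) with hW
  set B := exp (β ^ 2 + |h|) with hB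
  have hB0 : 0 < B := exp_pos _
  obtain ⟨hWint, hWle⟩ : Integrable W (μdis N) ∧ ∫ G, W G ∂μdis N ≤ exp (2 * β ^ 2 / 2) := by
    refine integral_tilt_le (T := univ.filter fun p => ¬ Touches i p)
      (U := univ.filter fun p => Touches i p) ?_ (fun σ => exp_pos _) (fun σ p hp => ?_)
      (fun σ p hp => ?_) (bondVec_touches_dotProduct_self_le β i)
    · exact (Finset.disjoint_filter_filter_not _ _ _).symm
    · simp only [mem_filter, mem_univ, true_and] at hp
      simp only [ha, bondVec, hp, if_false]
    · simp only [mem_filter, mem_univ, true_and] at hp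
      simp only [hb, bondVec, hp, if_false]
  have hpt : ∀ G, mavg β h G i ^ 2 ≤ 1 - (3 / B ^ 2 - 2 * (exp |h| * W G) / B ^ 3) := by
    intro G
    have hZ := Zpart_pos β h G
    have hS : 0 < ∑ τ, w τ * exp (a τ ⬝ᵥ G) :=
      Finset.sum_pos (fun _ _ => mul_pos (exp_pos _) (exp_pos _)) Finset.univ_nonempty
    have h1 := sq_sum_exp_le β h G i (fun σ => ham_eq_split β h G i σ)
      (fun σ => by
        rw [bondVec_not_touches_flipAt]
        congr 2
        exact Finset.sum_congr rfl fun j hj => by rw [flipAt_of_ne (Finset.ne_of_mem_erase hj)])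
      (fun σ => by rw [bondVec_touches_flipAt, spin_flipAt_self, neg_dotProduct]; ring)
    have hSe : ∑ σ, exp (bondVec β (fun p => ¬ Touches i p) σ ⬝ᵥ G +
        h * ∑ j ∈ univ.erase i, spin (σ j)) = ∑ τ, w τ * exp (a τ ⬝ᵥ G) :=
      Finset.sum_congr rfl fun σ _ => by rw [exp_add, mul_comm]
    rw [hSe] at h1
    set T := ∑ τ, w τ * exp (a τ ⬝ᵥ G) with hT
    have hZW : Zpart β h G / T ≤ exp |h| * W G := by
      rw [Zpart, Finset.sum_div, hW, Finset.mul_sum]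
      refine Finset.sum_le_sum fun σ _ => ?_
      have hs : h * spin (σ i) ≤ |h| := by
        refine (le_abs_self _).trans ?_
        rw [abs_mul, abs_spin, mul_one]
      rw [ham_eq_split β h G i σ, exp_add, exp_add, exp_add]
      have e : exp |h| * (w σ * exp (a σ ⬝ᵥ G) / T * exp (b σ ⬝ᵥ G)) =
        exp (a σ ⬝ᵥ G) * w σ * (exp (b σ ⬝ᵥ G) * exp |h|) / T := by ring
      simp only [← hT]
      rw [e]
      gcongr
    have h2 := tangent_le_inv_sq (div_pos hZ hS) hB0
    have h3 : 1 / (Zpart β h G / T) ^ 2 ≤ 1 - mavg β h G i ^ 2 := by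
      rw [div_pow, one_div_div, div_le_iff₀ (by positivity)]
      linarith
    have h4 : 2 * (Zpart β h G / T) / B ^ 3 ≤ 2 * (exp |h| * W G) / B ^ 3 := by gcongr
    linarith
  have hi : Integrable (fun G => 2 * (exp |h| * W G) / B ^ 3) (μdis N) :=
    ((hWint.const_mul _).const_mul _).div_const _
  calc _ ≤ ∫ G, 1 - (3 / B ^ 2 - 2 * (exp |h| * W G) / B ^ 3) ∂μdis N :=
        integral_mono (integrable_sq_mavg β h i)
          ((integrable_const _).sub ((integrable_const _).sub hi)) hpt
    _ = 1 - (3 / B ^ 2 - 2 * (exp |h| * ∫ G, W G ∂μdis N) / B ^ 3) := by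
        have hi' : Integrable (fun G => 3 / B ^ 2 - 2 * (exp |h| * W G) / B ^ 3) (μdis N) :=
          (integrable_const _).sub hi
        rw [integral_sub (integrable_const _) hi',
          integral_sub (integrable_const _) hi]
        simp only [integral_div, integral_const_mul]
        simp
    _ ≤ 1 - (3 / B ^ 2 - 2 * B / B ^ 3) := by
        have : exp |h| * ∫ G, W G ∂μdis N ≤ B := by
          rw [hB, add_comm, exp_add]
          gcongr
          exact hWle.trans_eq (by ring_nf)
        gcongr
    _ = 1 - 1 / B ^ 2 := by field_simp; ring
    _ = _ := by
        rw [hB, ← exp_nat_mul, one_div, ← exp_neg]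
        norm_num

end LowerBound

section Overlap

variable {N : ℕ} (β h : ℝ)

lemma integrable_qavg2 (f : Config N → Config N → ℝ) :
    Integrable (fun G => qavg2 β h G f) (μdis N) := by
  have hm := measurable_gibbs (N := N) β h
  have hle : ∀ (G : Disorder N) (σ : Config N), gibbs β h G σ ≤ 1 := fun G σ => by
    rw [← sum_gibbs β h G]
    exact Finset.single_le_sum (fun τ _ => gibbs_nonneg β h G τ) (Finset.mem_univ σ)
  refine integrable_finsetSum _ fun σ _ => integrable_finsetSum _ fun τ _ =>
    Integrable.of_bound (Measurable.aestronglyMeasurable (by fun_prop)) |f σ τ|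
      (ae_of_all _ fun G => ?_)
  rw [norm_mul, norm_mul, Real.norm_eq_abs, Real.norm_eq_abs, Real.norm_eq_abs,
    abs_of_nonneg (gibbs_nonneg β h G _), abs_of_nonneg (gibbs_nonneg β h G _), mul_assoc]
  exact mul_le_of_le_one_right (abs_nonneg _)
    (mul_le_one₀ (hle G σ) (gibbs_nonneg β h G τ) (hle G τ))

lemma qavg2_mono (G : Disorder N) {f f' : Config N → Config N → ℝ}
    (hf : ∀ σ τ, f σ τ ≤ f' σ τ) : qavg2 β h G f ≤ qavg2 β h G f' :=
  Finset.sum_le_sum fun σ _ => Finset.sum_le_sum fun τ _ =>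
    mul_le_mul_of_nonneg_right (mul_le_mul_of_nonneg_right (hf σ τ) (gibbs_nonneg β h G σ))
      (gibbs_nonneg β h G τ)

lemma qavg2_mul_add (G : Disorder N) (f : Config N → Config N → ℝ) (a b : ℝ) :
    qavg2 β h G (fun σ τ => a * f σ τ + b) = a * qavg2 β h G f + b := by
  have hb : ∑ σ, ∑ τ, b * gibbs β h G σ * gibbs β h G τ = b := by
    simp_rw [← Finset.mul_sum, sum_gibbs, mul_one, ← Finset.mul_sum, sum_gibbs, mul_one]
  simp only [qavg2, add_mul, Finset.sum_add_distrib, hb]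
  simp only [mul_assoc, Finset.mul_sum]

lemma qavg2_overlap (G : Disorder N) :
    qavg2 β h G overlap = (1 / (N : ℝ)) * ∑ i, mavg β h G i ^ 2 := by
  have e : ∀ i, mavg β h G i ^ 2 = ∑ σ : Config N, ∑ τ : Config N,
      spin (σ i) * spin (τ i) * gibbs β h G σ * gibbs β h G τ := by
    intro i
    rw [sq, mavg, qavg, Finset.sum_mul_sum]
    exact Finset.sum_congr rfl fun σ _ => Finset.sum_congr rfl fun τ _ => by ring
  simp only [e]
  rw [Finset.sum_comm, Finset.mul_sum, qavg2]
  refine Finset.sum_congr rfl fun σ _ => ?_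
  rw [Finset.sum_comm, Finset.mul_sum]
  refine Finset.sum_congr rfl fun τ _ => ?_
  simp only [overlap, Finset.mul_sum, Finset.sum_mul, mul_assoc]

lemma integral_qavg2_overlap_le (hN : 0 < N) :
    ∫ G, qavg2 β h G overlap ∂μdis N ≤ 1 - exp (-(2 * (β ^ 2 + |h|))) := by
  simp only [qavg2_overlap]
  rw [integral_const_mul, integral_finsetSum _ fun i _ => integrable_sq_mavg β h i]
  have hN' : (0 : ℝ) < N := by exact_mod_cast hN
  calc _ ≤ 1 / (N : ℝ) * ∑ _i : Fin N, (1 - exp (-(2 * (β ^ 2 + |h|)))) := by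
        gcongr with i
        exact integral_sq_mavg_le β h i
    _ = _ := by simp; field_simp

variable {β h} {q K : ℝ}

lemma integral_qavg2_abs_nonneg :
    0 ≤ ∫ G, qavg2 β h G (fun σ τ => |overlap σ τ - q|) ∂μdis N :=
  integral_nonneg fun G => Finset.sum_nonneg fun σ _ => Finset.sum_nonneg fun τ _ =>
    mul_nonneg (mul_nonneg (abs_nonneg _) (gibbs_nonneg β h G σ)) (gibbs_nonneg β h G τ)

/-- First absolute moment of the overlap fluctuation in the high temperature regime. -/
lemma integral_qavg2_abs_le (hN : 0 < N) (hT : highTemp N β h q K) :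
    ∫ G, qavg2 β h G (fun σ τ => |overlap σ τ - q|) ∂μdis N ≤ (K + 1) / √N := by
  have hN' : (0 : ℝ) < √N := sqrt_pos.2 (by exact_mod_cast hN)
  have hpow : (N : ℝ) = √N ^ 2 := (sq_sqrt (Nat.cast_nonneg N)).symm
  have young : ∀ x : ℝ, |x| ≤ √N ^ 3 * x ^ 4 + 1 / √N := by
    intro x
    rw [← Even.pow_abs (by decide : Even 4) x]
    have h0 := abs_nonneg x
    by_cases hx : |x| ≤ 1 / √N
    · have : 0 ≤ √N ^ 3 * |x| ^ 4 := by positivity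
      linarith
    · have h1 : 1 ≤ √N * |x| := by
        rw [not_le, div_lt_iff₀ hN'] at hx
        linarith
      have h2 : 1 ≤ (√N * |x|) ^ 3 := one_le_pow₀ h1
      have h3 : 0 < 1 / √N := by positivity
      nlinarith
  calc _ ≤ ∫ G, (√N ^ 3 * qavg2 β h G (fun σ τ => (overlap σ τ - q) ^ 4) + 1 / √N) ∂μdis N := by
        refine integral_mono (integrable_qavg2 β h _)
          (((integrable_qavg2 β h _).const_mul _).add (integrable_const _)) fun G => ?_
        simp only
        rw [← qavg2_mul_add]
        exact qavg2_mono β h G fun σ τ => young _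
    _ = √N ^ 3 * ∫ G, qavg2 β h G (fun σ τ => (overlap σ τ - q) ^ 4) ∂μdis N + 1 / √N := by
        rw [integral_add ((integrable_qavg2 β h _).const_mul _) (integrable_const _),
          integral_const_mul]
        simp
    _ ≤ √N ^ 3 * (K / (√N ^ 2) ^ 2) + 1 / √N := by
        rw [← hpow]
        gcongr
        exact hT
    _ = _ := by field_simp

/-- In the high temperature regime the variance of the cavity field cannot degenerate. -/
lemma exp_le_one_sub_add (hN : 0 < N) (hT : highTemp N β h q K) :
    exp (-(2 * (β ^ 2 + |h|))) ≤ 1 - q + (K + 1) / √N := by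
  have h1 := integral_qavg2_overlap_le (N := N) β h hN
  have h2 : ∫ G, (q - qavg2 β h G overlap) ∂μdis N ≤
      ∫ G, qavg2 β h G (fun σ τ => |overlap σ τ - q|) ∂μdis N := by
    refine integral_mono ((integrable_const _).sub (integrable_qavg2 β h _))
      (integrable_qavg2 β h _) fun G => ?_
    have := qavg2_mono β h G (f := fun σ τ => -1 * overlap σ τ + q)
      (f' := fun σ τ => |overlap σ τ - q|) fun σ τ => by
        linarith [neg_le_abs (overlap σ τ - q)]
    rw [qavg2_mul_add] at this
    have e : qavg2 β h G (fun σ τ => overlap σ τ) = qavg2 β h G overlap := rfl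
    simp only
    linarith
  rw [integral_sub (integrable_const _) (integrable_qavg2 β h _)] at h2
  simp only [integral_const, probReal_univ, one_smul] at h2
  linarith [integral_qavg2_abs_le hN hT]

end Overlap

lemma integral_mul_gaussDens (u : ℝ → ℝ) (m : ℝ) {v : ℝ} (hv : 0 < v) :
    ∫ t, u t * gaussDens m v t = ∫ t, u t ∂gaussianReal m v.toNNReal := by
  rw [integral_gaussianReal_eq_integral_smul (by simpa using hv)]
  refine integral_congr_ae (ae_of_all _ fun t => ?_)
  simp only [gaussDens, gaussianPDFReal, smul_eq_mul, coe_toNNReal _ hv.le]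
  rw [sqrt_mul (x := 2 * π) (by positivity), one_div, mul_comm]

/-- The configuration `σ` as a unit vector. -/
noncomputable def unitConfig {N : ℕ} (σ : Config N) : Fin N → ℝ := fun i => spin (σ i) / √N

lemma unitConfig_dotProduct {N : ℕ} (σ τ : Config N) :
    unitConfig σ ⬝ᵥ unitConfig τ = overlap σ τ := by
  simp only [dotProduct, unitConfig, overlap, Finset.mul_sum]
  refine Finset.sum_congr rfl fun i _ => ?_
  rw [div_mul_div_comm, mul_self_sqrt (Nat.cast_nonneg N)]
  ring

lemma unitConfig_dotProduct_self {N : ℕ} (hN : 0 < N) (σ : Config N) :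
    unitConfig σ ⬝ᵥ unitConfig σ = 1 := by
  have : (N : ℝ) ≠ 0 := by exact_mod_cast hN.ne'
  simp [unitConfig_dotProduct, overlap, spin_mul_self, this]

section CavityField

variable {N : ℕ} {β h q : ℝ} {u : ℝ → ℝ} {M : ℝ}

lemma cavity_integrand_eq (hq1 : q < 1) (G : Disorder N) (g : Fin N → ℝ) :
    (qavg β h G (fun σ => u ((1 / √N) * ∑ i, g i * spin (σ i))) -
      ∫ t, u t * gaussDens ((1 / √N) * ∑ i, g i * mavg β h G i) (1 - q) t) =
    ∑ σ, gibbs β h G σ * u (unitConfig σ ⬝ᵥ g) -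
      ∫ t, u t ∂gaussianReal ((∑ σ, gibbs β h G σ • unitConfig σ) ⬝ᵥ g) (1 - q).toNNReal := by
  have e1 : ∀ σ : Config N, (1 / √N) * ∑ i, g i * spin (σ i) = unitConfig σ ⬝ᵥ g := by
    intro σ
    rw [dotProduct, Finset.mul_sum]
    exact Finset.sum_congr rfl fun i _ => by rw [unitConfig]; ring
  have e2 : (1 / √N) * ∑ i, g i * mavg β h G i =
      (∑ σ, gibbs β h G σ • unitConfig σ) ⬝ᵥ g := by
    simp only [sum_dotProduct, smul_dotProduct, ← e1, mavg, qavg, smul_eq_mul, Finset.mul_sum]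
    rw [Finset.sum_comm]
    exact Finset.sum_congr rfl fun i _ => Finset.sum_congr rfl fun σ _ => by ring
  rw [integral_mul_gaussDens u _ (by linarith), e2, qavg]
  congr 1
  exact Finset.sum_congr rfl fun σ _ => by rw [e1, mul_comm]

lemma sq_cavity_integrand_le (huM : ∀ y, |u y| ≤ M) (hq1 : q < 1) (G : Disorder N)
    (g : Fin N → ℝ) :
    (qavg β h G (fun σ => u ((1 / √N) * ∑ i, g i * spin (σ i))) -
      ∫ t, u t * gaussDens ((1 / √N) * ∑ i, g i * mavg β h G i) (1 - q) t) ^ 2 ≤ 4 * M ^ 2 := by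
  rw [cavity_integrand_eq hq1]
  have h1 : |∑ σ, gibbs β h G σ * u (unitConfig σ ⬝ᵥ g)| ≤ M := by
    calc _ ≤ ∑ σ, |gibbs β h G σ * u (unitConfig σ ⬝ᵥ g)| := abs_sum_le_sum_abs _ _
      _ ≤ ∑ σ, gibbs β h G σ * M := Finset.sum_le_sum fun σ _ => by
        rw [abs_mul, abs_of_nonneg (gibbs_nonneg β h G σ)]
        exact mul_le_mul_of_nonneg_left (huM _) (gibbs_nonneg β h G σ)
      _ = M := by rw [← Finset.sum_mul, sum_gibbs, one_mul]
  have h2 : |∫ t, u t ∂gaussianReal ((∑ σ, gibbs β h G σ • unitConfig σ) ⬝ᵥ g)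
      (1 - q).toNNReal| ≤ M := by
    have := norm_integral_le_of_norm_le_const (μ := gaussianReal
      ((∑ σ, gibbs β h G σ • unitConfig σ) ⬝ᵥ g) (1 - q).toNNReal)
      (ae_of_all _ fun y => (Real.norm_eq_abs (u y)).trans_le (huM y))
    simpa using this
  have h3 := (abs_sub _ _).trans (add_le_add h1 h2)
  rw [← sq_abs]
  refine (pow_le_pow_left₀ (abs_nonneg _) h3 2).trans_eq (by ring)

lemma integral_sq_cavity_le (hN : 0 < N) (hq0 : 0 ≤ q) (hq1 : q < 1) (hu : Measurable u)
    (huM : ∀ y, |u y| ≤ M) :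
    ∫ ω, (qavg β h ω.1 (fun σ => u ((1 / √N) * ∑ i, ω.2 i * spin (σ i))) -
        ∫ t, u t * gaussDens ((1 / √N) * ∑ i, ω.2 i * mavg β h ω.1 i) (1 - q) t) ^ 2
      ∂((μdis N).prod (Measure.pi fun _ : Fin N => gaussianReal 0 1)) ≤
    48 * M ^ 2 / (1 - q) ^ 2 *
      ∫ G, qavg2 β h G (fun σ τ => |overlap σ τ - q|) ∂μdis N := by
  have hnn := integral_qavg2_abs_nonneg (N := N) (β := β) (h := h) (q := q)
  by_cases hint : Integrable (fun ω : Disorder N × (Fin N → ℝ) =>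
      (qavg β h ω.1 (fun σ => u ((1 / √N) * ∑ i, ω.2 i * spin (σ i))) -
        ∫ t, u t * gaussDens ((1 / √N) * ∑ i, ω.2 i * mavg β h ω.1 i) (1 - q) t) ^ 2)
      ((μdis N).prod (Measure.pi fun _ : Fin N => gaussianReal 0 1))
  · rw [integral_prod _ hint, ← integral_const_mul]
    refine integral_mono_of_nonneg (ae_of_all _ fun G => integral_nonneg fun g => sq_nonneg _)
      ((integrable_qavg2 β h _).const_mul _) (ae_of_all _ fun G => ?_)
    simp only [cavity_integrand_eq hq1]
    refine (integral_sq_mixture_sub_gaussian_le (gibbs_nonneg β h G) (sum_gibbs β h G)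
      (unitConfig_dotProduct_self hN) hq0 hq1 hu huM).trans_eq ?_
    congr 1
    refine Finset.sum_congr rfl fun σ _ => Finset.sum_congr rfl fun τ _ => ?_
    rw [unitConfig_dotProduct]
    ring
  · rw [integral_undef hint]
    positivity

end CavityField

/-- Theorem 1.5 (CLT for the cavity field): under the Gibbs measure, the cavity
field `ℓ = N^{-1/2} Σ g_i σ_i` is approximately Gaussian with mean `⟨ℓ⟩` and
variance `1 - q`.  The auxiliary Gaussians `g₁,…,g_N` are the second coordinate
of the product probability space. -/
theorem cavity_field_clt (β h K : ℝ) (hβ : 0 < β) (hK : 0 < K) :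
    ∃ C : ℝ, 0 < C ∧ ∀ (N : ℕ) (q : ℝ), 2 ≤ N → 0 ≤ q → q < 1 →
      highTemp N β h q K →
      ∀ u : ℝ → ℝ, Measurable u → ∀ M : ℝ, (∀ x, |u x| ≤ M) →
        ∫ ω, (qavg β h ω.1
              (fun σ => u ((1 / Real.sqrt N) * ∑ i, ω.2 i * spin (σ i)))
            - ∫ t, u t *
                gaussDens ((1 / Real.sqrt N) * ∑ i, ω.2 i * mavg β h ω.1 i)
                  (1 - q) t) ^ 2
          ∂((μdis N).prod (Measure.pi fun _ : Fin N => gaussianReal 0 1))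
        ≤ C * M ^ 2 / Real.sqrt N := by
  set c := exp (-(2 * (β ^ 2 + |h|))) with hc
  have hc0 : 0 < c := exp_pos _
  refine ⟨48 / (c / 2) ^ 2 * (K + 1) + 8 * (K + 1) / c, by positivity, ?_⟩
  intro N q hN hq0 hq1 hT u hu M huM
  have hN0 : 0 < N := by omega
  have hs : (0 : ℝ) < √N := sqrt_pos.2 (by exact_mod_cast hN0)
  have hκ := exp_le_one_sub_add hN0 hT
  rw [← hc] at hκ
  by_cases hsmall : (K + 1) / √N ≤ c / 2
  · refine (integral_sq_cavity_le hN0 hq0 hq1 hu huM).trans ?_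
    calc _ ≤ 48 * M ^ 2 / (c / 2) ^ 2 * ((K + 1) / √N) := by
          have h1 := integral_qavg2_abs_le hN0 hT
          have h2 : c / 2 ≤ 1 - q := by linarith
          have h3 := integral_qavg2_abs_nonneg (N := N) (β := β) (h := h) (q := q)
          gcongr
      _ = 48 / (c / 2) ^ 2 * (K + 1) * M ^ 2 / √N := by ring
      _ ≤ _ := by
          gcongr
          exact le_add_of_nonneg_right (by positivity)
  · rw [not_le, lt_div_iff₀ hs] at hsmall
    calc _ ≤ ∫ _, 4 * M ^ 2 ∂((μdis N).prod (Measure.pi fun _ : Fin N => gaussianReal 0 1)) :=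
          integral_mono_of_nonneg (ae_of_all _ fun _ => sq_nonneg _) (integrable_const _)
            (ae_of_all _ fun ω => sq_cavity_integrand_le huM hq1 ω.1 ω.2)
      _ = 4 * M ^ 2 := by simp
      _ ≤ 8 * (K + 1) / c * M ^ 2 / √N := by
          rw [le_div_iff₀ hs, mul_right_comm]
          gcongr
          rw [le_div_iff₀ hc0]
          linarith
      _ ≤ _ := by
          gcongr
          exact le_add_of_nonneg_left (by positivity)

end SK
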